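/- Fix a real number p ≥ 1 and a real number N > 0. Let μ_N be a random finite positive Borel measure on the square Q_N = [0,√N]² (a measurable map from a probability space to the space of finite measures) such that: (1) there exists a monotone (non-decreasing or non-increasing) function g : [1,∞) → (0,∞) such that for every axis-parallel square B ⊂ Q_N with |B| ≥ 1 one has E[|μ_N(B) − E[μ_N(B)]|^p] ≤ |B|^{p/2} g(|B|)^p; (2) there exist constants a ∈ (0,1] and A ∈ [1,∞) such that a|B| ≤ E[μ_N(B)] ≤ A|B| for every axis-parallel square B ⊂ Q_N. Let M_N = μ_N(Q_N) and define the random measure μ̄_N = (M_N / E[M_N]) · E[μ_N], of total mass M_N. Then there exists a constant C_p, depending only on p, such that E[W_p^p(μ_N, μ̄_N)] ≤ C_p a^{1−2p} A^p N (1 + ∫_1^{max(1,N)} g(y) y^{−1} dy)^p. -/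

import Mathlib

open MeasureTheory ENNReal

noncomputable section

/-- The `p`-th power of the `p`-Wasserstein distance between two positive Borel
measures on `ℝ^d`: infimum over couplings of the integral of `dist^p`. -/
def WpPow {d : ℕ} (p : ℝ)
    (μ ν : Measure (EuclideanSpace ℝ (Fin d))) : ℝ≥0∞ :=
  ⨅ π ∈ {π : Measure (EuclideanSpace ℝ (Fin d) × EuclideanSpace ℝ (Fin d)) |
      π.map Prod.fst = μ ∧ π.map Prod.snd = ν},
    ∫⁻ z, edist z.1 z.2 ^ p ∂π

/-- Axis-parallel square in `ℝ²`. -/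
def IsAxisSquare (B : Set (EuclideanSpace ℝ (Fin 2))) : Prop :=
  ∃ (c : EuclideanSpace ℝ (Fin 2)) (s : ℝ), 0 ≤ s ∧
    B = {x | ∀ i, c i ≤ x i ∧ x i ≤ c i + s}

/-- The square `Q_N = [0, √N]²`. -/
def QN (N : ℝ) : Set (EuclideanSpace ℝ (Fin 2)) :=
  {x | ∀ i, 0 ≤ x i ∧ x i ≤ Real.sqrt N}

/-- `μ` and `ν` admit a coupling whose `p`-cost is at most `K`. -/
def CoupledWithin {X : Type*} [MeasurableSpace X] [PseudoEMetricSpace X] (p : ℝ)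
    (μ ν : Measure X) (K : ℝ≥0∞) : Prop :=
  ∃ π : Measure (X × X), π.map Prod.fst = μ ∧ π.map Prod.snd = ν ∧
    ∫⁻ z, edist z.1 z.2 ^ p ∂π ≤ K

namespace CoupledWithin

variable {X : Type*} [MeasurableSpace X] [PseudoEMetricSpace X] {p : ℝ}
  {μ ν ρ μ' ν' : Measure X} {K K' : ℝ≥0∞}

theorem mono (h : CoupledWithin p μ ν K) (hK : K ≤ K') : CoupledWithin p μ ν K' := by
  obtain ⟨π, h1, h2, h3⟩ := h
  exact ⟨π, h1, h2, h3.trans hK⟩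

theorem symm [BorelSpace X] [SecondCountableTopology X] (h : CoupledWithin p μ ν K) :
    CoupledWithin p ν μ K := by
  obtain ⟨π, h1, h2, h3⟩ := h
  refine ⟨π.map Prod.swap, ?_, ?_, ?_⟩
  · rw [Measure.map_map measurable_fst measurable_swap]; exact h2
  · rw [Measure.map_map measurable_snd measurable_swap]; exact h1
  · rw [lintegral_map (by fun_prop) measurable_swap]
    simpa [edist_comm] using h3

theorem add (h : CoupledWithin p μ ν K) (h' : CoupledWithin p μ' ν' K') :
    CoupledWithin p (μ + μ') (ν + ν') (K + K') := by
  obtain ⟨π, h1, h2, h3⟩ := h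
  obtain ⟨π', h1', h2', h3'⟩ := h'
  refine ⟨π + π', ?_, ?_, ?_⟩
  · rw [Measure.map_add _ _ measurable_fst, h1, h1']
  · rw [Measure.map_add _ _ measurable_snd, h2, h2']
  · rw [lintegral_add_measure]
    gcongr

theorem of_map [BorelSpace X] [SecondCountableTopology X] (hp : 0 ≤ p) {T : X → X}
    (hT : Measurable T) {δ : ℝ≥0∞}
    (hδ : ∀ᵐ x ∂μ, edist x (T x) ≤ δ) :
    CoupledWithin p μ (μ.map T) (δ ^ p * μ Set.univ) := by
  have hm : Measurable fun x => (x, T x) := measurable_id.prodMk hT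
  refine ⟨μ.map fun x => (x, T x), ?_, ?_, ?_⟩
  · rw [Measure.map_map measurable_fst hm]; exact Measure.map_id
  · rw [Measure.map_map measurable_snd hm]; rfl
  · rw [lintegral_map (by fun_prop) hm, ← lintegral_const]
    refine lintegral_mono_ae ?_
    filter_upwards [hδ] with x hx
    exact ENNReal.rpow_le_rpow hx hp

theorem refl [BorelSpace X] [SecondCountableTopology X] (hp : 0 < p) (μ : Measure X) :
    CoupledWithin p μ μ 0 := by
  have := of_map (μ := μ) hp.le (T := id) measurable_id (δ := 0) (by simp)
  simpa [ENNReal.zero_rpow_of_pos hp] using this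

/-- Any two measures of equal mass carried by a set of small diameter are coupled cheaply. -/
theorem of_carried [BorelSpace X] [SecondCountableTopology X] [IsFiniteMeasure μ]
    [IsFiniteMeasure ν] (hp : 0 ≤ p)
    (hm : μ Set.univ = ν Set.univ) {S : Set X} (hμ : ∀ᵐ x ∂μ, x ∈ S) (hν : ∀ᵐ x ∂ν, x ∈ S)
    {δ : ℝ≥0∞} (hδ : ∀ x ∈ S, ∀ y ∈ S, edist x y ≤ δ) :
    CoupledWithin p μ ν (δ ^ p * μ Set.univ) := by
  by_cases h0 : μ Set.univ = 0
  · have h1 : μ = 0 := Measure.measure_univ_eq_zero.1 h0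
    have h2 : ν = 0 := Measure.measure_univ_eq_zero.1 (hm ▸ h0)
    exact ⟨0, by simp [h1], by simp [h2], by simp⟩
  have hc : μ Set.univ ≠ ∞ := measure_ne_top _ _
  refine ⟨(μ Set.univ)⁻¹ • μ.prod ν, ?_, ?_, ?_⟩
  · rw [Measure.map_smul, Measure.map_fst_prod, ← hm, smul_smul, ENNReal.inv_mul_cancel h0 hc,
      one_smul]
  · rw [Measure.map_smul, Measure.map_snd_prod, smul_smul, ENNReal.inv_mul_cancel h0 hc,
      one_smul]
  · rw [lintegral_smul_measure]
    have : ∫⁻ z, edist z.1 z.2 ^ p ∂(μ.prod ν) ≤ ∫⁻ z, δ ^ p ∂(μ.prod ν) := by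
      refine lintegral_mono_ae ?_
      have e1 : ∀ᵐ z ∂(μ.prod ν), z.1 ∈ S := Measure.quasiMeasurePreserving_fst.ae hμ
      have e2 : ∀ᵐ z ∂(μ.prod ν), z.2 ∈ S := Measure.quasiMeasurePreserving_snd.ae hν
      filter_upwards [e1, e2] with z h1 h2
      exact ENNReal.rpow_le_rpow (hδ _ h1 _ h2) hp
    calc (μ Set.univ)⁻¹ • ∫⁻ z, edist z.1 z.2 ^ p ∂(μ.prod ν)
        ≤ (μ Set.univ)⁻¹ * (δ ^ p * (μ Set.univ * μ Set.univ)) := by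
          rw [smul_eq_mul]
          gcongr
          refine this.trans ?_
          rw [lintegral_const, ← Set.univ_prod_univ, Measure.prod_prod, ← hm]
      _ = δ ^ p * μ Set.univ := by
          rw [mul_comm (δ ^ p), ← mul_assoc, ← mul_assoc, ENNReal.inv_mul_cancel h0 hc, one_mul,
            mul_comm]

/-- Gluing of couplings and Minkowski's inequality: the triangle inequality. -/
theorem trans [BorelSpace X] [SecondCountableTopology X] [StandardBorelSpace X] [Nonempty X]
    [IsFiniteMeasure μ]
    (hp : 1 ≤ p) (h : CoupledWithin p μ ν (K ^ p)) (h' : CoupledWithin p ν ρ (K' ^ p)) :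
    CoupledWithin p μ ρ ((K + K') ^ p) := by
  obtain ⟨π, h1, h2, h3⟩ := h
  obtain ⟨π', h1', h2', h3'⟩ := h'
  have p0 : 0 < p := by linarith
  have : IsFiniteMeasure π := by
    refine ⟨?_⟩
    have : π Set.univ = μ Set.univ := by rw [← h1, Measure.map_apply measurable_fst .univ]; rfl
    rw [this]; exact measure_lt_top _ _
  have : IsFiniteMeasure ν := h2 ▸ inferInstance
  have : IsFiniteMeasure π' := by
    refine ⟨?_⟩
    have : π' Set.univ = ν Set.univ := by rw [← h1', Measure.map_apply measurable_fst .univ]; rfl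
    rw [this]; exact measure_lt_top _ _
  set κ := π'.condKernel.comap (Prod.snd : X × X → X) measurable_snd with hκ
  set Θ : Measure ((X × X) × X) := π.compProd κ with hΘ
  have g1 : Θ.map Prod.fst = π := Measure.fst_compProd π κ
  have hm : Measurable fun t : (X × X) × X => (t.1.2, t.2) := by fun_prop
  have g2 : Θ.map (fun t => (t.1.2, t.2)) = π' := by
    conv_rhs => rw [← π'.disintegrate π'.condKernel]
    ext s hs
    rw [Measure.map_apply hm hs, hΘ, Measure.compProd_apply (hm hs), Measure.compProd_apply hs]
    have : π'.fst = π.map Prod.snd := by rw [h2]; exact h1'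
    rw [this, lintegral_map (ProbabilityTheory.Kernel.measurable_kernel_prodMk_left hs) measurable_snd]
    rfl
  have hm2 : Measurable fun t : (X × X) × X => (t.1.1, t.2) := by fun_prop
  refine ⟨Θ.map fun t => (t.1.1, t.2), ?_, ?_, ?_⟩
  · rw [Measure.map_map measurable_fst hm2, ← h1, ← g1, Measure.map_map measurable_fst measurable_fst]
    rfl
  · rw [Measure.map_map measurable_snd hm2, ← h2', ← g2, Measure.map_map measurable_snd hm]
    rfl
  · rw [lintegral_map (by fun_prop) hm2]
    have k1 : ∫⁻ t, edist t.1.1 t.1.2 ^ p ∂Θ ≤ K ^ p := by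
      rw [← g1, lintegral_map (by fun_prop) measurable_fst] at h3
      exact h3
    have k2 : ∫⁻ t, edist t.1.2 t.2 ^ p ∂Θ ≤ K' ^ p := by
      rw [← g2, lintegral_map (by fun_prop) hm] at h3'
      exact h3'
    have mk := ENNReal.lintegral_Lp_add_le (μ := Θ) (p := p)
      (f := fun t => edist t.1.1 t.1.2) (g := fun t => edist t.1.2 t.2)
      (by fun_prop) (by fun_prop) hp
    have e : ∫⁻ t : (X × X) × X, edist t.1.1 t.2 ^ p ∂Θ ≤
        ∫⁻ t, ((fun t : (X × X) × X => edist t.1.1 t.1.2) + fun t : (X × X) × X => edist t.1.2 t.2) t ^ p ∂Θ :=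
      lintegral_mono fun t => ENNReal.rpow_le_rpow (edist_triangle _ _ _) p0.le
    refine e.trans ?_
    rw [← ENNReal.rpow_inv_le_iff p0]
    rw [one_div] at mk
    refine mk.trans ?_
    gcongr
    · rwa [ENNReal.rpow_inv_le_iff p0]
    · rwa [ENNReal.rpow_inv_le_iff p0]

end CoupledWithin

theorem intervalIntegrable_of_mem_Icc {q : ℝ → ℝ} (hq : Measurable q) {lo hi : ℝ}
    (hb : ∀ t, q t ∈ Set.Icc lo hi) (u v : ℝ) : IntervalIntegrable q volume u v := by
  refine (intervalIntegrable_const (c := max |lo| |hi|)).mono_fun hq.aestronglyMeasurable ?_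
  refine Filter.Eventually.of_forall fun t => ?_
  change abs (q t) ≤ abs (max |lo| |hi|)
  rw [abs_of_nonneg (le_max_of_le_left (abs_nonneg _))]
  exact abs_le_max_abs_abs (hb t).1 (hb t).2

/-- A density bounded between positive constants is pushed to a multiple of Lebesgue measure by
(a multiple of) its primitive. -/
theorem map_primitive_withDensity {q : ℝ → ℝ} (hq : Measurable q) {lo hi : ℝ} (hlo : 0 < lo)
    (hb : ∀ t, q t ∈ Set.Icc lo hi) (x₀ : ℝ) {h : ℝ} (hh : 0 < h) {T : ℝ → ℝ}
    (hT : ∀ x, T x = x₀ + (∫ t in x₀..x, q t) / h) :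
    Continuous T ∧ StrictMono T ∧
      (volume.withDensity fun t => ENNReal.ofReal (q t)).map T = ENNReal.ofReal h • volume := by
  have hint := intervalIntegrable_of_mem_Icc hq hb
  have hdiff : ∀ u v, (T v - T u) * h = ∫ t in u..v, q t := by
    intro u v
    rw [hT, hT, ← intervalIntegral.integral_interval_sub_left (hint x₀ v) (hint x₀ u)]
    field_simp
    ring
  have hgrow : ∀ u v, u ≤ v → lo * (v - u) ≤ (T v - T u) * h := by
    intro u v huv
    rw [hdiff]
    have := intervalIntegral.integral_mono_on huv (intervalIntegrable_const (c := lo)) (hint u v)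
      fun t _ => (hb t).1
    simpa [mul_comm] using this
  have hcont : Continuous T := by
    have := intervalIntegral.continuous_primitive (μ := volume) hint x₀
    have h2 : T = fun x => x₀ + (∫ t in x₀..x, q t) / h := funext hT
    rw [h2]
    fun_prop
  have hmono : StrictMono T := by
    intro u v huv
    have := hgrow u v huv.le
    have h2 : 0 < (T v - T u) * h := lt_of_lt_of_le (by nlinarith) this
    have := pos_of_mul_pos_left h2 hh.le
    linarith
  have htop : Filter.Tendsto T Filter.atTop Filter.atTop := by
    refine Filter.tendsto_atTop_mono' _ (f₁ := fun x => T 0 + lo / h * x) ?_ ?_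
    · filter_upwards [Filter.eventually_ge_atTop 0] with x hx
      have := hgrow 0 x hx
      have h3 : lo / h * x = lo * (x - 0) / h := by ring
      rw [h3]
      have : lo * (x - 0) / h ≤ T x - T 0 := by rwa [div_le_iff₀ hh]
      linarith
    · exact Filter.tendsto_atTop_add_const_left _ _
        (Filter.tendsto_id.const_mul_atTop (by positivity))
  have hbot : Filter.Tendsto T Filter.atBot Filter.atBot := by
    refine Filter.tendsto_atBot_mono' _ (f₂ := T) (f₁ := fun x => T 0 + lo / h * x) ?_ ?_
    · filter_upwards [Filter.eventually_le_atBot 0] with x hx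
      have := hgrow x 0 hx
      have h3 : lo / h * x = - (lo * (0 - x) / h) := by ring
      rw [h3]
      have : lo * (0 - x) / h ≤ T 0 - T x := by rwa [div_le_iff₀ hh]
      linarith
    · exact Filter.tendsto_atBot_add_const_left _ _
        (Filter.tendsto_id.const_mul_atBot (by positivity))
  have hsurj := hcont.surjective htop hbot
  refine ⟨hcont, hmono, ?_⟩
  symm
  refine Measure.ext_of_Ioc' _ _ (fun a b _ => ?_) fun a b hab => ?_
  · simp [ENNReal.mul_eq_top]
  obtain ⟨u, rfl⟩ := hsurj a
  obtain ⟨v, rfl⟩ := hsurj b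
  have huv : u ≤ v := hmono.le_iff_le.1 hab.le
  have hpre : T ⁻¹' Set.Ioc (T u) (T v) = Set.Ioc u v := by
    ext x; simp [hmono.lt_iff_lt, hmono.le_iff_le]
  rw [Measure.map_apply hcont.measurable measurableSet_Ioc, hpre,
    withDensity_apply _ measurableSet_Ioc, ← ofReal_integral_eq_lintegral_ofReal,
    ← intervalIntegral.integral_of_le huv, ← hdiff, Measure.smul_apply, Real.volume_Ioc,
    smul_eq_mul, ← ENNReal.ofReal_mul hh.le, mul_comm]
  · exact (intervalIntegrable_iff_integrableOn_Ioc_of_le huv).1 (hint u v)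
  · exact Filter.Eventually.of_forall fun t => hlo.le.trans (hb t).1

theorem abs_integral_sub_le {q : ℝ → ℝ} (hq : Measurable q) {l ρ : ℝ}
    (hb : ∀ t, |q t - l| ≤ ρ) {u v : ℝ} (huv : u ≤ v) :
    |(∫ t in u..v, q t) - l * (v - u)| ≤ ρ * (v - u) := by
  have hint := intervalIntegrable_of_mem_Icc hq (lo := l - ρ) (hi := l + ρ) (fun t => by
    have := abs_le.1 (hb t); constructor <;> linarith) u v
  have h1 : (∫ t in u..v, q t) - l * (v - u) = ∫ t in u..v, (q t - l) := by
    rw [intervalIntegral.integral_sub hint intervalIntegrable_const]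
    simp [mul_comm]
  rw [h1]
  have := intervalIntegral.norm_integral_le_of_norm_le_const (f := fun t => q t - l) (C := ρ)
    (a := u) (b := v) (fun t _ => hb t)
  rwa [abs_of_nonneg (by linarith : 0 ≤ v - u)] at this

/-- Rearranging a nearly constant density along horizontal lines, so that it becomes constant
on each horizontal segment over `[x₀, x₀ + s)`. -/
theorem exists_horizontal_rearrangement {q : ℝ × ℝ → ℝ} (hq : Measurable q) {l ρ : ℝ}
    (hl : 0 < l) (hρ : ρ ≤ l / 2) (hb : ∀ z, |q z - l| ≤ ρ) (x₀ : ℝ) {s : ℝ} (hs : 0 < s)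
    {H : ℝ → ℝ} (hH : ∀ y, H y = (∫ t in x₀..(x₀ + s), q (t, y)) / s) :
    Measurable H ∧ (∀ y, |H y - l| ≤ ρ) ∧ ∃ T : ℝ → ℝ → ℝ, Measurable (Function.uncurry T) ∧
      (volume.withDensity fun z => ENNReal.ofReal (q z)).map (fun z : ℝ × ℝ => (T z.1 z.2, z.2)) =
        volume.withDensity (fun z => ENNReal.ofReal (H z.2)) ∧
      (∀ x y, T x y ∈ Set.Ico x₀ (x₀ + s) ↔ x ∈ Set.Ico x₀ (x₀ + s)) ∧
      ∀ x y, x ∈ Set.Ico x₀ (x₀ + s) → |T x y - x| ≤ 4 * s * ρ / l := by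
  have hρ0 : 0 ≤ ρ := (abs_nonneg _).trans (hb (0, 0))
  have hqy : ∀ y, Measurable fun t => q (t, y) := fun y => hq.comp measurable_prodMk_right
  have hmeas : ∀ x, Measurable fun y => ∫ t in x₀..x, q (t, y) := by
    intro x
    have : ∀ S : Set ℝ, Measurable fun y => ∫ t in S, q (t, y) := fun S =>
      (StronglyMeasurable.integral_prod_left' (μ := volume.restrict S)
        hq.stronglyMeasurable).measurable
    exact (this _).sub (this _)
  have hbd : ∀ y t, q (t, y) ∈ Set.Icc (l / 2) (2 * l) := fun y t => by
    have := abs_le.1 (hb (t, y)); constructor <;> linarith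
  have hHm : Measurable H := by
    rw [funext hH]; exact (hmeas _).div_const _
  have hHl : ∀ y, |H y - l| ≤ ρ := by
    intro y
    have := abs_integral_sub_le (hqy y) (fun t => hb (t, y)) (by linarith : x₀ ≤ x₀ + s)
    rw [hH, div_sub' hs.ne', abs_div, abs_of_pos hs, div_le_iff₀ hs]
    simpa [mul_comm] using this
  have hHpos : ∀ y, l / 2 ≤ H y := fun y => by have := abs_le.1 (hHl y); linarith
  refine ⟨hHm, hHl, fun x y => x₀ + (∫ t in x₀..x, q (t, y)) / H y, ?_⟩
  have key := fun y => map_primitive_withDensity (hqy y) (by positivity) (hbd y) x₀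
    (h := H y) (by linarith [hHpos y]) (T := fun x => x₀ + (∫ t in x₀..x, q (t, y)) / H y)
    (fun x => rfl)
  set T : ℝ → ℝ → ℝ := fun x y => x₀ + (∫ t in x₀..x, q (t, y)) / H y with hT
  have hTm : Measurable (Function.uncurry T) :=
    measurable_uncurry_of_continuous_of_measurable (fun y => (key y).1)
      fun x => (((hmeas x).div hHm).const_add x₀)
  have hT0 : ∀ y, T x₀ y = x₀ := fun y => by simp [hT]
  have hT1 : ∀ y, T (x₀ + s) y = x₀ + s := fun y => by
    have h0 : 0 < H y := by linarith [hHpos y]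
    have h1 : (∫ t in x₀..(x₀ + s), q (t, y)) = H y * s := by rw [hH]; field_simp
    simp only [hT, h1]; field_simp
  refine ⟨hTm, ?_, ?_, ?_⟩
  · have hm : Measurable fun z : ℝ × ℝ => (T z.1 z.2, z.2) := hTm.prodMk measurable_snd
    ext S hS
    rw [Measure.map_apply hm hS, withDensity_apply _ (hm hS), withDensity_apply _ hS,
      ← lintegral_indicator (hm hS), ← lintegral_indicator hS, Measure.volume_eq_prod,
      lintegral_prod_symm', lintegral_prod_symm']
    · refine lintegral_congr fun y => ?_
      have hSy : MeasurableSet ((fun x => (x, y)) ⁻¹' S) := measurable_prodMk_right hS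
      have hTy : Measurable fun x => T x y := (key y).1.measurable
      have e := DFunLike.congr_fun (key y).2.2 ((fun x => (x, y)) ⁻¹' S)
      rw [Measure.map_apply hTy hSy, withDensity_apply _ (hTy hSy),
        ← lintegral_indicator (hTy hSy)] at e
      refine e.trans ?_
      rw [Measure.smul_apply, smul_eq_mul, ← setLIntegral_const, ← lintegral_indicator hSy]
      rfl
    · exact (hHm.comp measurable_snd).ennreal_ofReal.indicator hS
    · exact hq.ennreal_ofReal.indicator (hm hS)
  · intro x y
    have hm := (key y).2.1
    have a1 : x₀ ≤ T x y ↔ x₀ ≤ x := by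
      conv_lhs => rw [← hT0 y]
      exact hm.le_iff_le
    have a2 : T x y < x₀ + s ↔ x < x₀ + s := by
      conv_lhs => rw [← hT1 y]
      exact hm.lt_iff_lt
    simp only [Set.mem_Ico, a1, a2]
  · intro x y hx
    have h0 : 0 < H y := by linarith [hHpos y]
    have h1 := abs_integral_sub_le (hqy y) (fun t => hb (t, y)) hx.1
    set F := ∫ t in x₀..x, q (t, y) with hF
    have e : T x y - x = (F - H y * (x - x₀)) / H y := by
      simp only [hT]; field_simp; ring
    rw [e, abs_div, abs_of_pos h0, div_le_div_iff₀ h0 hl]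
    have h2 := hHl y
    have h3 : |F - H y * (x - x₀)| ≤ 2 * ρ * s := by
      have : F - H y * (x - x₀) = (F - l * (x - x₀)) - (H y - l) * (x - x₀) := by ring
      rw [this]
      refine (abs_sub _ _).trans ?_
      rw [abs_mul, abs_of_nonneg (by linarith [hx.1] : 0 ≤ x - x₀)]
      have : x - x₀ ≤ s := by linarith [hx.2]
      have : 0 ≤ x - x₀ := by linarith [hx.1]
      nlinarith
    have h4 := hHpos y
    have : 0 ≤ ρ * s := by positivity
    nlinarith

/-- The half-open axis-parallel square with lower left corner `(x, y)` and side `s`. -/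
def halfOpenSquare (x y s : ℝ) : Set (ℝ × ℝ) := Set.Ico x (x + s) ×ˢ Set.Ico y (y + s)

theorem measurableSet_halfOpenSquare (x y s : ℝ) : MeasurableSet (halfOpenSquare x y s) :=
  measurableSet_Ico.prod measurableSet_Ico

theorem volume_halfOpenSquare (x y : ℝ) {s : ℝ} (hs : 0 ≤ s) :
    volume (halfOpenSquare x y s) = ENNReal.ofReal (s ^ 2) := by
  rw [halfOpenSquare, Measure.volume_eq_prod, Measure.prod_prod, Real.volume_Ico, Real.volume_Ico,
    ← ENNReal.ofReal_mul (by linarith)]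
  congr 1; ring

theorem volume_halfOpenSquare_ne_top (x y s : ℝ) : volume (halfOpenSquare x y s) ≠ ∞ := by
  rw [halfOpenSquare, Measure.volume_eq_prod, Measure.prod_prod, Real.volume_Ico, Real.volume_Ico]
  exact ENNReal.mul_ne_top ofReal_ne_top ofReal_ne_top

theorem edist_le_of_mem_halfOpenSquare {x y s : ℝ} {z w : ℝ × ℝ} (hz : z ∈ halfOpenSquare x y s)
    (hw : w ∈ halfOpenSquare x y s) : edist z w ≤ ENNReal.ofReal s := by
  obtain ⟨⟨h1, h2⟩, h3, h4⟩ := hz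
  obtain ⟨⟨h5, h6⟩, h7, h8⟩ := hw
  rw [edist_dist, Prod.dist_eq, Real.dist_eq, Real.dist_eq]
  refine ENNReal.ofReal_le_ofReal (max_le ?_ ?_) <;> rw [abs_le] <;> constructor <;> linarith

theorem integrableOn_halfOpenSquare {q : ℝ × ℝ → ℝ} (hq : Measurable q) {C : ℝ}
    (hb : ∀ z, |q z| ≤ C) (x y s : ℝ) : IntegrableOn q (halfOpenSquare x y s) :=
  Measure.integrableOn_of_bounded (M := C) (volume_halfOpenSquare_ne_top x y s)
    hq.aestronglyMeasurable (Filter.Eventually.of_forall hb)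

theorem withDensity_ofReal_add {X : Type*} [MeasurableSpace X] (m : Measure X) {u v : X → ℝ}
    (hu : Measurable u) (hu0 : ∀ z, 0 ≤ u z) (hv0 : ∀ z, 0 ≤ v z) :
    m.withDensity (fun z => ENNReal.ofReal (u z + v z)) =
      m.withDensity (fun z => ENNReal.ofReal (u z)) +
        m.withDensity fun z => ENNReal.ofReal (v z) := by
  rw [← withDensity_add_left hu.ennreal_ofReal]
  congr 1
  ext z
  exact ENNReal.ofReal_add (hu0 z) (hv0 z)

theorem map_swap_withDensity {f : ℝ × ℝ → ℝ≥0∞} (hf : Measurable f) :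
    (volume.withDensity f).map Prod.swap = volume.withDensity fun z => f z.swap := by
  have hp : MeasurePreserving (Prod.swap : ℝ × ℝ → ℝ × ℝ) volume volume := by
    rw [Measure.volume_eq_prod]; exact Measure.measurePreserving_swap
  ext S hS
  rw [Measure.map_apply measurable_swap hS, withDensity_apply _ (measurable_swap hS),
    withDensity_apply _ hS]
  have := hp.setLIntegral_comp_preimage hS (hf.comp measurable_swap)
  simpa using this

/-- A nearly constant density on a square can be rearranged to a constant one, moving each point
by at most a small amount. -/
theorem coupledWithin_of_nearly_constant {p : ℝ} (hp : 0 ≤ p) {q : ℝ × ℝ → ℝ} (hq : Measurable q)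
    {l ρ : ℝ} (hl : 0 < l) (hρ : ρ ≤ l / 2) (hb : ∀ z, |q z - l| ≤ ρ) (x₀ y₀ : ℝ) {s : ℝ}
    (hs : 0 < s) (hint : ∫ z in halfOpenSquare x₀ y₀ s, q z = l * s ^ 2) :
    CoupledWithin p
      ((volume.restrict (halfOpenSquare x₀ y₀ s)).withDensity fun z => ENNReal.ofReal (q z))
      ((volume.restrict (halfOpenSquare x₀ y₀ s)).withDensity fun _ => ENNReal.ofReal l)
      (ENNReal.ofReal ((4 * s * ρ / l) ^ p * (l * s ^ 2))) := by
  have hρ0 : 0 ≤ ρ := (abs_nonneg _).trans (hb (0, 0))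
  set H : ℝ → ℝ := fun y => (∫ t in x₀..(x₀ + s), q (t, y)) / s with hH
  obtain ⟨hHm, hHl, T, hTm, hTmap, hTmem, hTd⟩ :=
    exists_horizontal_rearrangement hq hl hρ hb x₀ hs (H := H) (fun _ => rfl)
  have hqI : IntegrableOn q (halfOpenSquare x₀ y₀ s) :=
    integrableOn_halfOpenSquare hq (C := 2 * l) (fun z => by
      have := abs_le.1 (hb z)
      rw [abs_le]; constructor <;> linarith) _ _ _
  have hHint : (∫ y in y₀..(y₀ + s), H y) / s = l := by
    have : ∫ z in halfOpenSquare x₀ y₀ s, q z = ∫ y in y₀..(y₀ + s), ∫ t in x₀..(x₀ + s), q (t, y) := by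
      rw [intervalIntegral.integral_of_le (by linarith), ← integral_Ico_eq_integral_Ioc]
      rw [halfOpenSquare, Measure.volume_eq_prod, ← Measure.prod_restrict]
      rw [integral_prod_symm]
      · refine integral_congr_ae (Filter.Eventually.of_forall fun y => ?_)
        simp only []
        rw [intervalIntegral.integral_of_le (by linarith), ← integral_Ico_eq_integral_Ioc]
      · rw [IntegrableOn, halfOpenSquare, Measure.volume_eq_prod, ← Measure.prod_restrict] at hqI
        exact hqI
    simp only [hH, intervalIntegral.integral_div]
    rw [← this, hint]
    field_simp
  obtain ⟨-, -, T', hTm', hTmap', hTmem', hTd'⟩ :=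
    exists_horizontal_rearrangement (q := fun z => H z.1) (hHm.comp measurable_fst) hl hρ
      (fun z => hHl z.1) y₀ hs (H := fun _ => l) (fun _ => hHint.symm)
  set S : ℝ × ℝ → ℝ × ℝ := fun z => (T z.1 z.2, z.2) with hS
  set S' : ℝ × ℝ → ℝ × ℝ := fun z => (T' z.1 z.2, z.2) with hS'
  have hSm : Measurable S := hTm.prodMk measurable_snd
  have hSm' : Measurable S' := hTm'.prodMk measurable_snd
  set Ψ : ℝ × ℝ → ℝ × ℝ := fun z => (S' (S z).swap).swap with hΨ
  have hΨm : Measurable Ψ := measurable_swap.comp (hSm'.comp (measurable_swap.comp hSm))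
  have hmap : (volume.withDensity fun z => ENNReal.ofReal (q z)).map Ψ =
      volume.withDensity fun _ => ENNReal.ofReal l := by
    have : Ψ = Prod.swap ∘ S' ∘ Prod.swap ∘ S := rfl
    rw [this, ← Measure.map_map measurable_swap (hSm'.comp (measurable_swap.comp hSm)),
      ← Measure.map_map hSm' (measurable_swap.comp hSm), ← Measure.map_map measurable_swap hSm,
      hTmap, map_swap_withDensity (by fun_prop)]
    simp only [Prod.snd_swap]
    rw [hTmap', map_swap_withDensity (by fun_prop)]
  have hBm := measurableSet_halfOpenSquare x₀ y₀ s
  have hpre : Ψ ⁻¹' halfOpenSquare x₀ y₀ s = halfOpenSquare x₀ y₀ s := by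
    ext z
    simp only [halfOpenSquare, Set.mem_preimage, Set.mem_prod, hΨ, hS, hS', Prod.swap, hTmem,
      hTmem']
  have hmapB : ((volume.restrict (halfOpenSquare x₀ y₀ s)).withDensity
      fun z => ENNReal.ofReal (q z)).map Ψ =
      (volume.restrict (halfOpenSquare x₀ y₀ s)).withDensity fun _ => ENNReal.ofReal l := by
    rw [← restrict_withDensity hBm, ← restrict_withDensity hBm, ← hmap,
      Measure.restrict_map hΨm hBm, hpre]
  have key := CoupledWithin.of_map (p := p) (T := Ψ) hp hΨm (δ := ENNReal.ofReal (4 * s * ρ / l))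
    (μ := (volume.restrict (halfOpenSquare x₀ y₀ s)).withDensity fun z => ENNReal.ofReal (q z)) ?_
  · rw [hmapB] at key
    refine key.mono (le_of_eq ?_)
    rw [withDensity_apply _ .univ, Measure.restrict_univ, ← ofReal_integral_eq_lintegral_ofReal hqI,
      hint, ENNReal.ofReal_rpow_of_nonneg (by positivity) hp, ← ENNReal.ofReal_mul (by positivity)]
    refine Filter.Eventually.of_forall fun z => ?_
    have := abs_le.1 (hb z)
    change 0 ≤ q z
    linarith
  · refine (withDensity_absolutelyContinuous _ _).ae_le ?_
    refine (ae_restrict_iff' hBm).2 (Filter.Eventually.of_forall fun z hz => ?_)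
    rw [edist_dist, dist_comm, Prod.dist_eq, Real.dist_eq, Real.dist_eq]
    exact ENNReal.ofReal_le_ofReal (max_le (hTd _ _ hz.1) (hTd' _ _ hz.2))

/-- The part of the mass common to two densities need not be moved. -/
theorem coupledWithin_of_integral_abs_sub {p : ℝ} (hp : 0 < p) {u w : ℝ × ℝ → ℝ}
    (hu : Measurable u) (hw : Measurable w) (hu0 : ∀ z, 0 ≤ u z) (hw0 : ∀ z, 0 ≤ w z)
    {x y s : ℝ} (hs : 0 ≤ s)
    (hui : IntegrableOn u (halfOpenSquare x y s)) (hwi : IntegrableOn w (halfOpenSquare x y s))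
    (hint : ∫ z in halfOpenSquare x y s, u z = ∫ z in halfOpenSquare x y s, w z) :
    CoupledWithin p
      ((volume.restrict (halfOpenSquare x y s)).withDensity fun z => ENNReal.ofReal (u z))
      ((volume.restrict (halfOpenSquare x y s)).withDensity fun z => ENNReal.ofReal (w z))
      (ENNReal.ofReal (s ^ p * ∫ z in halfOpenSquare x y s, |u z - w z|)) := by
  set B := halfOpenSquare x y s with hB
  have hBm : MeasurableSet B := measurableSet_halfOpenSquare x y s
  have decomp : ∀ u w : ℝ × ℝ → ℝ, Measurable u → Measurable w → (∀ z, 0 ≤ u z) →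
      (∀ z, 0 ≤ w z) → (volume.restrict B).withDensity (fun z => ENNReal.ofReal (u z)) =
      (volume.restrict B).withDensity (fun z => ENNReal.ofReal (min (u z) (w z))) +
        (volume.restrict B).withDensity fun z => ENNReal.ofReal (max (u z - w z) 0) := by
    intro u w hu hw hu0 hw0
    rw [← withDensity_ofReal_add _ (hu.min hw) (fun z => le_min (hu0 z) (hw0 z))
      fun z => le_max_right _ _]
    congr 1
    ext z
    congr 1
    rcases le_total (u z) (w z) with h | h
    · rw [min_eq_left h, max_eq_right (by linarith)]; ring
    · rw [min_eq_right h, max_eq_left (by linarith)]; ring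
  have hi1 : IntegrableOn (fun z => max (u z - w z) 0) B := (hui.sub hwi).pos_part
  have hi2 : IntegrableOn (fun z => max (w z - u z) 0) B := (hwi.sub hui).pos_part
  have m1 : ((volume.restrict B).withDensity fun z => ENNReal.ofReal (max (u z - w z) 0)) Set.univ
      = ENNReal.ofReal (∫ z in B, max (u z - w z) 0) := by
    rw [withDensity_apply _ .univ, Measure.restrict_univ, ofReal_integral_eq_lintegral_ofReal hi1
      (Filter.Eventually.of_forall fun z => le_max_right _ _)]
  have m2 : ((volume.restrict B).withDensity fun z => ENNReal.ofReal (max (w z - u z) 0)) Set.univ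
      = ENNReal.ofReal (∫ z in B, max (w z - u z) 0) := by
    rw [withDensity_apply _ .univ, Measure.restrict_univ, ofReal_integral_eq_lintegral_ofReal hi2
      (Filter.Eventually.of_forall fun z => le_max_right _ _)]
  have heq : ∫ z in B, max (u z - w z) 0 = ∫ z in B, max (w z - u z) 0 := by
    rw [← sub_eq_zero, ← integral_sub hi1 hi2]
    have : ∀ z, max (u z - w z) 0 - max (w z - u z) 0 = u z - w z := fun z => by
      rcases le_total (u z) (w z) with h | h
      · rw [max_eq_right (by linarith), max_eq_left (by linarith)]; ring
      · rw [max_eq_left (by linarith), max_eq_right (by linarith)]; ring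
    simp only [this]
    rw [integral_sub hui hwi, hint, sub_self]
  have : IsFiniteMeasure
      ((volume.restrict B).withDensity fun z => ENNReal.ofReal (max (u z - w z) 0)) :=
    ⟨by rw [m1]; exact ofReal_lt_top⟩
  have : IsFiniteMeasure
      ((volume.restrict B).withDensity fun z => ENNReal.ofReal (max (w z - u z) 0)) :=
    ⟨by rw [m2]; exact ofReal_lt_top⟩
  have hae : ∀ v : ℝ × ℝ → ℝ≥0∞, ∀ᵐ z ∂((volume.restrict B).withDensity v), z ∈ B := fun v =>
    (withDensity_absolutelyContinuous _ _).ae_le (ae_restrict_mem hBm)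
  have key := CoupledWithin.of_carried hp.le (by rw [m1, m2, heq]) (hae _) (hae _)
    (δ := ENNReal.ofReal s) (fun z hz w hw => edist_le_of_mem_halfOpenSquare hz hw)
    (μ := (volume.restrict B).withDensity fun z => ENNReal.ofReal (max (u z - w z) 0))
    (ν := (volume.restrict B).withDensity fun z => ENNReal.ofReal (max (w z - u z) 0))
  have key2 := (CoupledWithin.refl hp
    ((volume.restrict B).withDensity fun z => ENNReal.ofReal (min (u z) (w z)))).add key
  rw [decomp u w hu hw hu0 hw0, decomp w u hw hu hw0 hu0]
  simp only [min_comm (w _) (u _)]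
  refine key2.mono ?_
  rw [zero_add, m1, ENNReal.ofReal_rpow_of_nonneg hs hp.le, ← ENNReal.ofReal_mul (by positivity)]
  refine ENNReal.ofReal_le_ofReal ?_
  gcongr ?_ * ?_
  refine integral_mono hi1 (hui.sub hwi).abs fun z => ?_
  exact max_le (le_abs_self _) (abs_nonneg _)

/-- Changing the constant multiple of a reference density `f` into a function `c'` close to it:
small perturbations are rearranged, large ones are moved across the square. -/
theorem coupledWithin_of_perturbation {p : ℝ} (hp : 1 ≤ p) {f : ℝ × ℝ → ℝ} (hf : Measurable f)
    {a A : ℝ} (ha : 0 < a) (ha1 : a ≤ 1) (hA : 1 ≤ A) (hb : ∀ z, f z ∈ Set.Icc a A)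
    {x y s : ℝ} (hs : 0 < s) {c : ℝ} (hc : 0 ≤ c) {c' : ℝ × ℝ → ℝ} (hc' : Measurable c')
    (hc0 : ∀ z, 0 ≤ c' z) {D : ℝ} (hD : 0 ≤ D) (h1 : |c - 1| ≤ D / (a * s ^ 2))
    (h5 : ∀ z, |c' z - c| ≤ 5 * D / (a * s ^ 2))
    (hint : ∫ z in halfOpenSquare x y s, c * f z = ∫ z in halfOpenSquare x y s, c' z * f z)
    (habs : ∫ z in halfOpenSquare x y s, |c * f z - c' z * f z| ≤ 2 * D) :
    CoupledWithin p
      ((volume.restrict (halfOpenSquare x y s)).withDensity fun z => ENNReal.ofReal (c * f z))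
      ((volume.restrict (halfOpenSquare x y s)).withDensity fun z => ENNReal.ofReal (c' z * f z))
      (ENNReal.ofReal ((80 * A * D / (a ^ 2 * s)) ^ p * (a * s ^ 2))) := by
  have p0 : 0 < p := by linarith
  have hf0 : ∀ z, 0 < f z := fun z => ha.trans_le (hb z).1
  have hcf : IntegrableOn (fun z => c * f z) (halfOpenSquare x y s) :=
    integrableOn_halfOpenSquare (by fun_prop) (C := c * A) (fun z => by
      rw [abs_of_nonneg (mul_nonneg hc (hf0 z).le)]
      exact mul_le_mul_of_nonneg_left (hb z).2 hc) _ _ _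
  have hcf' : IntegrableOn (fun z => c' z * f z) (halfOpenSquare x y s) :=
    integrableOn_halfOpenSquare (by fun_prop) (C := (c + 5 * D / (a * s ^ 2)) * A) (fun z => by
      rw [abs_of_nonneg (mul_nonneg (hc0 z) (hf0 z).le)]
      have := abs_le.1 (h5 z)
      exact mul_le_mul (by linarith) (hb z).2 (hf0 z).le (by linarith [hc0 z])) _ _ _
  by_cases hcase : D ≤ a ^ 2 * s ^ 2 / (40 * A)
  · set l := a / 4 with hl
    set ρ := 5 * D / (a * s ^ 2) * A with hρ
    have hsmall : D / (a * s ^ 2) ≤ a / (40 * A) := by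
      rw [div_le_div_iff₀ (by positivity) (by positivity)]
      rw [le_div_iff₀ (by positivity)] at hcase
      nlinarith
    have hρl : ρ ≤ l / 2 := by
      have : ρ = 5 * A * (D / (a * s ^ 2)) := by rw [hρ]; ring
      rw [this, hl]
      calc 5 * A * (D / (a * s ^ 2)) ≤ 5 * A * (a / (40 * A)) := by gcongr
        _ = a / 4 / 2 := by field_simp; norm_num
    have hc2 : 1 / 2 ≤ c := by
      have : a / (40 * A) ≤ 1 / 2 := by
        rw [div_le_div_iff₀ (by positivity) (by norm_num)]; linarith
      have := abs_le.1 (h1.trans hsmall)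
      linarith
    have hqb : ∀ z, |(l + (c' z * f z - c * f z)) - l| ≤ ρ := fun z => by
      have : (l + (c' z * f z - c * f z)) - l = (c' z - c) * f z := by ring
      rw [this, abs_mul, abs_of_pos (hf0 z), hρ]
      exact mul_le_mul (h5 z) (hb z).2 (hf0 z).le (by positivity)
    have hl0 : 0 < l := by positivity
    have hvol : (volume.restrict (halfOpenSquare x y s)).real Set.univ = s ^ 2 := by
      rw [measureReal_restrict_apply_univ, measureReal_def, volume_halfOpenSquare _ _ hs.le,
        ENNReal.toReal_ofReal (by positivity)]
    have hfin : IsFiniteMeasure (volume.restrict (halfOpenSquare x y s)) :=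
      ⟨by simpa using (volume_halfOpenSquare_ne_top x y s).lt_top⟩
    have hqint : ∫ z in halfOpenSquare x y s, (l + (c' z * f z - c * f z)) = l * s ^ 2 := by
      have hsub : IntegrableOn (fun z => c' z * f z - c * f z) (halfOpenSquare x y s) :=
        hcf'.sub hcf
      rw [integral_add (integrable_const _) hsub, integral_sub hcf' hcf, hint, sub_self,
        add_zero, integral_const, hvol, smul_eq_mul, mul_comm]
    have key := (coupledWithin_of_nearly_constant p0.le (q := fun z => l + (c' z * f z - c * f z))
      (by fun_prop) hl0 hρl hqb x y hs hqint).symm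
    have hβ : ∀ z, 0 ≤ c * f z - l := fun z => by
      have := (hb z).1
      nlinarith
    have key2 := (CoupledWithin.refl p0 ((volume.restrict (halfOpenSquare x y s)).withDensity
      fun z => ENNReal.ofReal (c * f z - l))).add key
    rw [← withDensity_ofReal_add _ (by fun_prop) hβ fun _ => hl0.le,
      ← withDensity_ofReal_add _ (by fun_prop) hβ fun z => by linarith [(abs_le.1 (hqb z)).1]] at key2
    have e1 : ∀ z, c * f z - l + l = c * f z := fun z => by ring
    have e2 : ∀ z, c * f z - l + (l + (c' z * f z - c * f z)) = c' z * f z := fun z => by ring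
    simp only [e1, e2, zero_add] at key2
    refine key2.mono (ENNReal.ofReal_le_ofReal ?_)
    have e3 : 4 * s * ρ / l = 80 * A * D / (a ^ 2 * s) := by
      rw [hρ, hl]; field_simp; ring
    rw [e3]
    gcongr
    linarith
  · push Not at hcase
    have key := coupledWithin_of_integral_abs_sub p0 (u := fun z => c * f z)
      (w := fun z => c' z * f z) (by fun_prop) (by fun_prop) (fun z => mul_nonneg hc (hf0 z).le)
      (fun z => mul_nonneg (hc0 z) (hf0 z).le) hs.le hcf hcf' hint
    refine key.mono (ENNReal.ofReal_le_ofReal ?_)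
    set t := 40 * A * D / (a ^ 2 * s ^ 2) with ht
    have ht1 : 1 ≤ t := by
      rw [ht, le_div_iff₀ (by positivity)]
      rw [div_lt_iff₀ (by positivity)] at hcase
      linarith
    have htp : t ≤ t ^ p := Real.self_le_rpow_of_one_le ht1 hp
    have hDt : D = t * (a ^ 2 * s ^ 2 / (40 * A)) := by rw [ht]; field_simp
    have e : 80 * A * D / (a ^ 2 * s) = s * (2 * t) := by rw [ht]; field_simp; ring
    have h2 : 1 ≤ (2 : ℝ) ^ p := Real.one_le_rpow (by norm_num) p0.le
    rw [e, Real.mul_rpow hs.le (by positivity), Real.mul_rpow (by norm_num) (by positivity),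
      mul_assoc]
    gcongr
    refine habs.trans ?_
    have h3 : a ^ 2 * s ^ 2 / (40 * A) ≤ a * s ^ 2 / 2 := by
      rw [div_le_div_iff₀ (by positivity) (by norm_num)]
      have : a * (a * s ^ 2 * 2) ≤ 1 * (a * s ^ 2 * 2) := by gcongr
      have : a * s ^ 2 * 2 * 1 ≤ a * s ^ 2 * 2 * A := by gcongr
      have : 0 ≤ a * s ^ 2 * A := by positivity
      nlinarith
    calc 2 * D = 2 * (t * (a ^ 2 * s ^ 2 / (40 * A))) := by rw [← hDt]
      _ ≤ 2 * (t * (a * s ^ 2 / 2)) := by gcongr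
      _ = 1 * t * (a * s ^ 2) := by ring
      _ ≤ 2 ^ p * t ^ p * (a * s ^ 2) := by gcongr

/-- The four quarters of a half-open square. -/
def quarter (x y s : ℝ) (i : Bool × Bool) : Set (ℝ × ℝ) :=
  halfOpenSquare (x + cond i.1 (s / 2) 0) (y + cond i.2 (s / 2) 0) (s / 2)

theorem mem_quarter {x y s : ℝ} (_hs : 0 ≤ s) {i : Bool × Bool} {z : ℝ × ℝ} :
    z ∈ quarter x y s i ↔ z ∈ halfOpenSquare x y s ∧
      (decide (x + s / 2 ≤ z.1), decide (y + s / 2 ≤ z.2)) = i := by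
  obtain ⟨b, b'⟩ := i
  have aux : ∀ (u t : ℝ) (b : Bool), t ∈ Set.Ico (u + cond b (s / 2) 0)
      (u + cond b (s / 2) 0 + s / 2) ↔ t ∈ Set.Ico u (u + s) ∧ decide (u + s / 2 ≤ t) = b := by
    intro u t b
    cases b <;> simp only [cond_true, cond_false, Set.mem_Ico, decide_eq_true_eq,
      decide_eq_false_iff_not, not_le]
    · constructor
      · rintro ⟨h1, h2⟩; exact ⟨⟨by linarith, by linarith⟩, by linarith⟩
      · rintro ⟨⟨h1, h2⟩, h3⟩; exact ⟨by linarith, by linarith⟩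
    · constructor
      · rintro ⟨h1, h2⟩; exact ⟨⟨by linarith, by linarith⟩, by linarith⟩
      · rintro ⟨⟨h1, h2⟩, h3⟩; exact ⟨by linarith, by linarith⟩
  simp only [quarter, halfOpenSquare, Set.mem_prod, aux, Prod.mk.injEq]
  tauto

theorem iUnion_quarter {s : ℝ} (hs : 0 ≤ s) (x y : ℝ) :
    ⋃ i, quarter x y s i = halfOpenSquare x y s := by
  ext z
  simp [mem_quarter hs]

theorem quarter_subset {s : ℝ} (hs : 0 ≤ s) (x y : ℝ) (i : Bool × Bool) :
    quarter x y s i ⊆ halfOpenSquare x y s := fun _ hz => ((mem_quarter hs).1 hz).1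

theorem measurableSet_quarter (x y s : ℝ) (i : Bool × Bool) : MeasurableSet (quarter x y s i) :=
  measurableSet_halfOpenSquare _ _ _

theorem pairwise_disjoint_quarter {s : ℝ} (hs : 0 ≤ s) (x y : ℝ) :
    Pairwise (Function.onFun Disjoint (quarter x y s)) := by
  intro i j hij
  refine Set.disjoint_left.2 fun z hi hj => hij ?_
  rw [← ((mem_quarter hs).1 hi).2, ← ((mem_quarter hs).1 hj).2]

theorem restrict_eq_sum_quarter {s : ℝ} (hs : 0 ≤ s) (x y : ℝ) (m : Measure (ℝ × ℝ)) :
    m.restrict (halfOpenSquare x y s) = ∑ i, m.restrict (quarter x y s i) := by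
  rw [← iUnion_quarter hs, Measure.restrict_iUnion (pairwise_disjoint_quarter hs x y)
    (measurableSet_quarter x y s), Measure.sum_fintype]

theorem measure_eq_sum_quarter {s : ℝ} (hs : 0 ≤ s) (x y : ℝ) (m : Measure (ℝ × ℝ)) :
    m (halfOpenSquare x y s) = ∑ i, m (quarter x y s i) := by
  have := congrArg (fun m => m Set.univ) (restrict_eq_sum_quarter hs x y m)
  simpa using this

theorem setIntegral_eq_sum_quarter {s : ℝ} (hs : 0 ≤ s) (x y : ℝ) {h : ℝ × ℝ → ℝ}
    (hi : IntegrableOn h (halfOpenSquare x y s)) :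
    ∫ z in halfOpenSquare x y s, h z = ∑ i, ∫ z in quarter x y s i, h z := by
  rw [← iUnion_quarter hs, integral_iUnion_fintype (measurableSet_quarter x y s)
    (pairwise_disjoint_quarter hs x y) fun i => hi.mono_set (quarter_subset hs x y i)]

/-- The restriction of `E` to `B`, rescaled to have the same mass as `m` there. -/
def rescaledRestrict (E m : Measure (ℝ × ℝ)) (B : Set (ℝ × ℝ)) : Measure (ℝ × ℝ) :=
  (m B / E B) • E.restrict B

theorem rescaledRestrict_withDensity {f : ℝ × ℝ → ℝ} (hf : Measurable f) (hf0 : ∀ z, 0 ≤ f z)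
    (m : Measure (ℝ × ℝ)) [IsFiniteMeasure m] {B : Set (ℝ × ℝ)} (hB : MeasurableSet B)
    (hi : IntegrableOn f B) (hpos : 0 < ∫ z in B, f z) :
    rescaledRestrict (volume.withDensity fun z => ENNReal.ofReal (f z)) m B =
      (volume.restrict B).withDensity
        fun z => ENNReal.ofReal ((m.real B / ∫ z in B, f z) * f z) := by
  have h0 : 0 ≤ m.real B / ∫ z in B, f z := by positivity
  rw [rescaledRestrict, withDensity_apply _ hB, ← ofReal_integral_eq_lintegral_ofReal hi
    (Filter.Eventually.of_forall hf0), restrict_withDensity hB,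
    ← ofReal_measureReal (measure_ne_top m B), ← ENNReal.ofReal_div_of_pos hpos,
    ← withDensity_smul _ hf.ennreal_ofReal]
  congr 1
  ext z
  simp [ENNReal.ofReal_mul h0]

theorem mul_sq_le_setIntegral {f : ℝ × ℝ → ℝ} (hf : Measurable f) {a A : ℝ}
    (hb : ∀ z, f z ∈ Set.Icc a A) (x y : ℝ) {s : ℝ} (hs : 0 ≤ s) :
    IntegrableOn f (halfOpenSquare x y s) ∧ a * s ^ 2 ≤ ∫ z in halfOpenSquare x y s, f z ∧
      ∫ z in halfOpenSquare x y s, f z ≤ A * s ^ 2 := by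
  have hi : IntegrableOn f (halfOpenSquare x y s) :=
    integrableOn_halfOpenSquare hf (C := max |a| |A|)
      (fun z => abs_le_max_abs_abs (hb z).1 (hb z).2) _ _ _
  have hvol : (volume.restrict (halfOpenSquare x y s)).real Set.univ = s ^ 2 := by
    rw [measureReal_restrict_apply_univ, measureReal_def, volume_halfOpenSquare _ _ hs,
      ENNReal.toReal_ofReal (by positivity)]
  have hfin : IsFiniteMeasure (volume.restrict (halfOpenSquare x y s)) :=
    ⟨by simpa using (volume_halfOpenSquare_ne_top x y s).lt_top⟩
  refine ⟨hi, ?_, ?_⟩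
  · have := integral_mono (integrable_const a) hi fun z => (hb z).1
    rwa [integral_const, hvol, smul_eq_mul, mul_comm] at this
  · have := integral_mono hi (integrable_const A) fun z => (hb z).2
    rwa [integral_const, hvol, smul_eq_mul, mul_comm (s ^ 2)] at this

/-- Cost of redistributing the mass of a square among its four quarters. -/
theorem coupledWithin_quarter {p : ℝ} (hp : 1 ≤ p) {f : ℝ × ℝ → ℝ} (hf : Measurable f)
    {a A : ℝ} (ha : 0 < a) (ha1 : a ≤ 1) (hA : 1 ≤ A) (hb : ∀ z, f z ∈ Set.Icc a A)
    (m : Measure (ℝ × ℝ)) [IsFiniteMeasure m] (x y : ℝ) {s : ℝ} (hs : 0 < s) {D : ℝ}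
    (hD : D = ∑ i, |m.real (quarter x y s i) - ∫ z in quarter x y s i, f z|) :
    CoupledWithin p
      (∑ i, rescaledRestrict (volume.withDensity fun z => ENNReal.ofReal (f z)) m
        (quarter x y s i))
      (rescaledRestrict (volume.withDensity fun z => ENNReal.ofReal (f z)) m
        (halfOpenSquare x y s))
      (ENNReal.ofReal ((80 * A * D / (a ^ 2 * s)) ^ p * (a * s ^ 2))) := by
  have hf0 : ∀ z, 0 ≤ f z := fun z => ha.le.trans (hb z).1
  obtain ⟨hBi, hBa, -⟩ := mul_sq_le_setIntegral hf hb x y hs.le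
  have hqa : ∀ i, a * (s / 2) ^ 2 ≤ ∫ z in quarter x y s i, f z := fun i =>
    (mul_sq_le_setIntegral hf hb _ _ (by positivity)).2.1
  have hqi : ∀ i, IntegrableOn f (quarter x y s i) := fun i =>
    hBi.mono_set (quarter_subset hs.le x y i)
  have hBpos : 0 < ∫ z in halfOpenSquare x y s, f z := lt_of_lt_of_le (by positivity) hBa
  have hqpos : ∀ i, 0 < ∫ z in quarter x y s i, f z := fun i =>
    lt_of_lt_of_le (by positivity) (hqa i)
  have hesum := setIntegral_eq_sum_quarter hs.le x y hBi
  have hmsum : m.real (halfOpenSquare x y s) = ∑ i, m.real (quarter x y s i) := by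
    simp only [measureReal_def]
    rw [measure_eq_sum_quarter hs.le, ENNReal.toReal_sum fun i _ => measure_ne_top _ _]
  set e := ∫ z in halfOpenSquare x y s, f z with he
  set ei : Bool × Bool → ℝ := fun i => ∫ z in quarter x y s i, f z with hei
  set c := m.real (halfOpenSquare x y s) / e with hc
  set ci : Bool × Bool → ℝ := fun i => m.real (quarter x y s i) / ei i with hci
  set idx : ℝ × ℝ → Bool × Bool :=
    fun z => (decide (x + s / 2 ≤ z.1), decide (y + s / 2 ≤ z.2)) with hidx
  have hidxm : Measurable idx := by
    refine Measurable.prodMk ?_ ?_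
    · exact measurable_to_bool (by
        convert! measurableSet_le (measurable_const (a := x + s / 2)) measurable_fst using 1
        ext z; simp)
    · exact measurable_to_bool (by
        convert! measurableSet_le (measurable_const (a := y + s / 2)) measurable_snd using 1
        ext z; simp)
  have hidxq : ∀ i z, z ∈ quarter x y s i → idx z = i := fun i z hz =>
    ((mem_quarter hs.le).1 hz).2
  set c' : ℝ × ℝ → ℝ := fun z => ci (idx z) with hc'
  have hc'm : Measurable c' := (measurable_of_countable ci).comp hidxm
  have hci0 : ∀ i, 0 ≤ ci i := fun i => div_nonneg measureReal_nonneg (hqpos i).le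
  have hDi : ∀ i, |m.real (quarter x y s i) - ei i| ≤ D := fun i => by
    rw [hD]
    exact Finset.single_le_sum (f := fun i => |m.real (quarter x y s i) - ei i|)
      (fun i _ => abs_nonneg _) (Finset.mem_univ i)
  have hD0 : 0 ≤ D := (abs_nonneg _).trans (hDi (true, true))
  have hdev : |m.real (halfOpenSquare x y s) - e| ≤ D := by
    rw [hmsum, hesum, ← Finset.sum_sub_distrib, hD]
    exact Finset.abs_sum_le_sum_abs _ _
  have hc1 : |c - 1| ≤ D / (a * s ^ 2) := by
    rw [hc, div_sub_one hBpos.ne', abs_div, abs_of_pos hBpos]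
    gcongr
  have hci1 : ∀ i, |ci i - 1| ≤ 4 * D / (a * s ^ 2) := fun i => by
    simp only [hci]
    rw [div_sub_one (hqpos i).ne', abs_div, abs_of_pos (hqpos i)]
    calc _ ≤ D / (a * (s / 2) ^ 2) := by
          gcongr
          · exact hDi i
          · exact hqa i
      _ = 4 * D / (a * s ^ 2) := by field_simp; norm_num
  have hcc : ∀ i, |ci i - c| ≤ 5 * D / (a * s ^ 2) := fun i => by
    have : ci i - c = (ci i - 1) - (c - 1) := by ring
    rw [this]
    refine (abs_sub _ _).trans ((add_le_add (hci1 i) hc1).trans (le_of_eq ?_))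
    ring
  have hci_abs : IntegrableOn (fun z => |c * f z - c' z * f z|) (halfOpenSquare x y s) := by
    refine integrableOn_halfOpenSquare (by fun_prop) (C := 5 * D / (a * s ^ 2) * A) (fun z => ?_) _ _ _
    rw [abs_abs, ← sub_mul, abs_mul, abs_sub_comm, abs_of_nonneg (hf0 z)]
    exact mul_le_mul (hcc _) (hb z).2 (hf0 z) (by positivity)
  have hc'i : IntegrableOn (fun z => c' z * f z) (halfOpenSquare x y s) := by
    refine integrableOn_halfOpenSquare (by fun_prop) (C := (c + 5 * D / (a * s ^ 2)) * A)
      (fun z => ?_) _ _ _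
    rw [abs_of_nonneg (mul_nonneg (hci0 _) (hf0 z))]
    have := abs_le.1 (hcc (idx z))
    exact mul_le_mul (by linarith) (hb z).2 (hf0 z)
      (by linarith [hci0 (idx z)])
  have h1 : ∀ i, ∫ z in quarter x y s i, c' z * f z = m.real (quarter x y s i) := fun i => by
    rw [setIntegral_congr_fun (measurableSet_quarter x y s i)
      (g := fun z => ci i * f z) (fun z hz => by simp only [hc', hidxq i z hz]),
      integral_const_mul]
    exact div_mul_cancel₀ _ (hqpos i).ne'
  have h2 : ∀ i, ∫ z in quarter x y s i, |c * f z - c' z * f z| ≤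
      |m.real (quarter x y s i) - ei i| + |c - 1| * ei i := fun i => by
    rw [setIntegral_congr_fun (measurableSet_quarter x y s i)
      (g := fun z => |c - ci i| * f z) (fun z hz => by
        simp only [hc', hidxq i z hz]
        rw [← sub_mul, abs_mul, abs_of_nonneg (hf0 z)]), integral_const_mul]
    have e1 : m.real (quarter x y s i) - ei i = (ci i - 1) * ei i := by
      simp only [hci]; rw [sub_mul, div_mul_cancel₀ _ (hqpos i).ne']; ring
    have e2 : |m.real (quarter x y s i) - ei i| = |ci i - 1| * ei i := by
      rw [e1, abs_mul, abs_of_pos (hqpos i)]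
    rw [e2, ← add_mul]
    refine mul_le_mul_of_nonneg_right ?_ (hqpos i).le
    have : c - ci i = (c - 1) - (ci i - 1) := by ring
    rw [this, add_comm]
    exact abs_sub _ _
  have key := (coupledWithin_of_perturbation hp hf ha ha1 hA hb hs (x := x) (y := y) (c := c)
    (by positivity) hc'm (fun z => hci0 _) hD0 hc1 (fun z => hcc _) ?_ ?_).symm
  · rw [rescaledRestrict_withDensity hf hf0 m (measurableSet_halfOpenSquare x y s) hBi hBpos]
    convert! key using 1
    rw [← restrict_withDensity (measurableSet_halfOpenSquare x y s), restrict_eq_sum_quarter hs.le]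
    refine Finset.sum_congr rfl fun i _ => ?_
    rw [rescaledRestrict_withDensity hf hf0 m (measurableSet_quarter x y s i) (hqi i) (hqpos i),
      restrict_withDensity (measurableSet_quarter x y s i)]
    refine withDensity_congr_ae ?_
    refine (ae_restrict_iff' (measurableSet_quarter x y s i)).2
      (Filter.Eventually.of_forall fun z hz => ?_)
    simp only [hc', hidxq i z hz, hci, hei]
  · rw [setIntegral_eq_sum_quarter hs.le x y hc'i, integral_const_mul]
    simp only [h1]
    rw [← hmsum]
    exact div_mul_cancel₀ _ hBpos.ne'
  · rw [setIntegral_eq_sum_quarter hs.le x y hci_abs]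
    refine (Finset.sum_le_sum fun i _ => h2 i).trans ?_
    rw [Finset.sum_add_distrib, ← hD, ← Finset.mul_sum]
    have e3 : ∑ i, ei i = e := hesum.symm
    have e4 : |c - 1| * e = |m.real (halfOpenSquare x y s) - e| := by
      rw [hc, div_sub_one hBpos.ne', abs_div, abs_of_pos hBpos, div_mul_cancel₀ _ hBpos.ne']
    rw [e3, e4]
    linarith

theorem CoupledWithin.sum {X ι : Type*} [MeasurableSpace X] [PseudoEMetricSpace X] {p : ℝ}
    {μ ν : ι → Measure X} {K : ι → ℝ≥0∞} (t : Finset ι)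
    (h : ∀ i ∈ t, CoupledWithin p (μ i) (ν i) (K i)) :
    CoupledWithin p (∑ i ∈ t, μ i) (∑ i ∈ t, ν i) (∑ i ∈ t, K i) := by
  classical
  induction t using Finset.induction_on with
  | empty => exact ⟨0, by simp, by simp, by simp⟩
  | insert j t hj ih =>
    rw [Finset.sum_insert hj, Finset.sum_insert hj, Finset.sum_insert hj]
    exact (h j (Finset.mem_insert_self _ _)).add
      (ih fun i hi => h i (Finset.mem_insert_of_mem hi))

/-- Summing the costs of all dyadic scales, from squares of side at most `4` up. -/
theorem exists_multiscale_coupling {p : ℝ} (hp : 1 ≤ p) {f : ℝ × ℝ → ℝ} (hf : Measurable f)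
    {a A : ℝ} (ha : 0 < a) (ha1 : a ≤ 1) (hA : 1 ≤ A) (hb : ∀ z, f z ∈ Set.Icc a A)
    {Ω : Type*} [MeasurableSpace Ω] (P : Measure Ω) (μ : Ω → Measure (ℝ × ℝ))
    (hfin : ∀ ω, IsFiniteMeasure (μ ω))
    (hmeas : ∀ B, MeasurableSet B → Measurable fun ω => μ ω B) (Q : Set (ℝ × ℝ))
    (hmean : ∀ x y s, 0 ≤ s → halfOpenSquare x y s ⊆ Q →
      ∫⁻ ω, μ ω (halfOpenSquare x y s) ∂P ≤
        ENNReal.ofReal (∫ z in halfOpenSquare x y s, f z))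
    (g : ℝ → ℝ) (hg : ∀ t, 1 ≤ t → 0 < g t)
    (hmom : ∀ x y s, 1 ≤ s → halfOpenSquare x y s ⊆ Q →
      ∫⁻ ω, ENNReal.ofReal (|(μ ω).real (halfOpenSquare x y s) -
        ∫ z in halfOpenSquare x y s, f z| ^ p) ∂P ≤ ENNReal.ofReal (s ^ p * g (s ^ 2) ^ p))
    (n : ℕ) : ∀ x y s : ℝ, 0 < s → s ≤ 4 * 2 ^ n → (n ≠ 0 → 2 ^ n ≤ s) →
      halfOpenSquare x y s ⊆ Q → ∃ w : Ω → ℝ≥0∞, Measurable w ∧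
        (∀ ω, CoupledWithin p ((μ ω).restrict (halfOpenSquare x y s))
          (rescaledRestrict (volume.withDensity fun z => ENNReal.ofReal (f z)) (μ ω)
            (halfOpenSquare x y s)) (w ω ^ p)) ∧
        ∫⁻ ω, w ω ^ p ∂P ≤ ENNReal.ofReal ((A / a ^ 2) ^ p * a * s ^ 2) *
          ENNReal.ofReal (4 + ∑ j ∈ Finset.range n, 160 * g (s ^ 2 / 4 ^ (j + 1))) ^ p := by
  have p0 : 0 < p := by linarith
  have hf0 : ∀ z, 0 ≤ f z := fun z => ha.le.trans (hb z).1
  induction n with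
  | zero =>
    intro x y s hs hs4 _ hQ
    obtain ⟨hBi, hBa, hBA⟩ := mul_sq_le_setIntegral hf hb x y hs.le
    have hBm := measurableSet_halfOpenSquare x y s
    have hpow : ∀ t : ℝ≥0∞, (t ^ p⁻¹) ^ p = t := fun t => ENNReal.rpow_inv_rpow p0.ne' t
    refine ⟨fun ω => (ENNReal.ofReal s ^ p * μ ω (halfOpenSquare x y s)) ^ p⁻¹,
      ((hmeas _ hBm).const_mul _).pow_const _, fun ω => ?_, ?_⟩
    · have hE : (volume.withDensity fun z => ENNReal.ofReal (f z)) (halfOpenSquare x y s) =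
          ENNReal.ofReal (∫ z in halfOpenSquare x y s, f z) := by
        rw [withDensity_apply _ hBm, ofReal_integral_eq_lintegral_ofReal hBi
          (Filter.Eventually.of_forall hf0)]
      have hE0 : (volume.withDensity fun z => ENNReal.ofReal (f z)) (halfOpenSquare x y s) ≠ 0 := by
        rw [hE, Ne, ENNReal.ofReal_eq_zero, not_le]
        exact lt_of_lt_of_le (by positivity) hBa
      have hmass : rescaledRestrict (volume.withDensity fun z => ENNReal.ofReal (f z)) (μ ω)
          (halfOpenSquare x y s) Set.univ = μ ω (halfOpenSquare x y s) := by
        rw [rescaledRestrict, Measure.smul_apply, Measure.restrict_apply_univ, smul_eq_mul,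
          ENNReal.div_mul_cancel hE0 (by rw [hE]; exact ofReal_ne_top)]
      have : IsFiniteMeasure (rescaledRestrict (volume.withDensity fun z => ENNReal.ofReal (f z))
          (μ ω) (halfOpenSquare x y s)) := ⟨by rw [hmass]; exact measure_lt_top _ _⟩
      have key := CoupledWithin.of_carried p0.le (μ := (μ ω).restrict (halfOpenSquare x y s))
        (ν := rescaledRestrict (volume.withDensity fun z => ENNReal.ofReal (f z)) (μ ω)
          (halfOpenSquare x y s)) (by rw [hmass, Measure.restrict_apply_univ])
        (ae_restrict_mem hBm)
        (Measure.ae_smul_measure (ae_restrict_mem hBm) _)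
        (δ := ENNReal.ofReal s) fun z hz w hw => edist_le_of_mem_halfOpenSquare hz hw
      rw [Measure.restrict_apply_univ] at key
      rwa [hpow]
    · simp only [hpow]
      rw [lintegral_const_mul _ (hmeas _ hBm)]
      refine (mul_le_mul_right (hmean x y s hs.le hQ) _).trans ?_
      rw [ENNReal.ofReal_rpow_of_nonneg hs.le p0.le, ← ENNReal.ofReal_mul (by positivity),
        ENNReal.ofReal_rpow_of_nonneg (by simp) p0.le, ← ENNReal.ofReal_mul (by positivity)]
      refine ENNReal.ofReal_le_ofReal ?_
      have h1 : 1 ≤ A / a ^ 2 := by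
        rw [le_div_iff₀ (by positivity)]; nlinarith
      have h2 : A ≤ (A / a ^ 2) ^ p * a := by
        calc A ≤ A / a ^ 2 * a := by
              rw [div_mul_eq_mul_div, le_div_iff₀ (by positivity)]
              have : a ^ 2 ≤ a := by nlinarith
              gcongr
          _ ≤ _ := by
              gcongr
              exact Real.self_le_rpow_of_one_le h1 hp
      simp only [Finset.range_zero, Finset.sum_empty, add_zero]
      calc s ^ p * ∫ z in halfOpenSquare x y s, f z ≤ 4 ^ p * (A * s ^ 2) :=
            mul_le_mul (Real.rpow_le_rpow hs.le (by simpa using hs4) p0.le) hBA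
              (le_trans (by positivity) hBa) (by positivity)
        _ = A * s ^ 2 * 4 ^ p := by ring
        _ ≤ _ := by gcongr
  | succ n ih =>
    intro x y s hs hs4 hsn hQ
    have hsn' : 2 * 2 ^ n ≤ s := by
      have := hsn (by simp); rwa [pow_succ, mul_comm] at this
    have hn1 : (1 : ℝ) ≤ 2 ^ n := one_le_pow₀ (by norm_num)
    have hs2 : 1 ≤ s / 2 := by linarith
    have hsub : ∀ i, quarter x y s i ⊆ Q := fun i => (quarter_subset hs.le x y i).trans hQ
    have hih : ∀ i : Bool × Bool, _ := fun i =>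
      ih (x + cond i.1 (s / 2) 0) (y + cond i.2 (s / 2) 0) (s / 2) (by positivity)
        (by rw [pow_succ] at hs4; linarith) (fun _ => by linarith) (hsub i)
    choose w hwm hwc hwi using hih
    set U := 4 + ∑ j ∈ Finset.range n, 160 * g ((s / 2) ^ 2 / 4 ^ (j + 1)) with hU
    set G := g ((s / 2) ^ 2) with hG
    have hG0 : 0 < G := hg _ (one_le_pow₀ hs2)
    have hU' : 4 + ∑ j ∈ Finset.range (n + 1), 160 * g (s ^ 2 / 4 ^ (j + 1)) = U + 160 * G := by
      rw [Finset.sum_range_succ', hU, add_assoc, hG]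
      have : s ^ 2 / 4 ^ (0 + 1) = (s / 2) ^ 2 := by ring
      rw [this]
      congr 2
      refine Finset.sum_congr rfl fun j _ => ?_
      have : s ^ 2 / 4 ^ (j + 1 + 1) = (s / 2) ^ 2 / 4 ^ (j + 1) := by
        rw [pow_succ _ (j + 1)]; field_simp; norm_num
      rw [this]
    have hU0 : 0 ≤ U := by
      have : ∀ j ∈ Finset.range n, 0 ≤ 160 * g ((s / 2) ^ 2 / 4 ^ (j + 1)) := fun j hj => by
        have hjn : j + 1 ≤ n := Finset.mem_range.1 hj
        have h4 : (4 : ℝ) ^ (j + 1) ≤ (s / 2) ^ 2 := by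
          calc (4 : ℝ) ^ (j + 1) ≤ 4 ^ n := pow_le_pow_right₀ (by norm_num) hjn
            _ = (2 ^ n) ^ 2 := by rw [← pow_mul, mul_comm, pow_mul]; norm_num
            _ ≤ (s / 2) ^ 2 := by gcongr; linarith
        have := hg ((s / 2) ^ 2 / 4 ^ (j + 1)) (by rwa [le_div_iff₀ (by positivity), one_mul])
        positivity
      have := Finset.sum_nonneg this
      linarith
    set D : Ω → ℝ := fun ω =>
      ∑ i, |(μ ω).real (quarter x y s i) - ∫ z in quarter x y s i, f z| with hD
    have hDm : Measurable D := Finset.measurable_sum _ fun i _ =>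
      (((hmeas _ (measurableSet_quarter x y s i)).ennreal_toReal).sub_const _).abs
    have hD0 : ∀ ω, 0 ≤ D ω := fun ω => Finset.sum_nonneg fun i _ => abs_nonneg _
    set w₀ : Ω → ℝ≥0∞ := fun ω =>
      ENNReal.ofReal ((80 * A * D ω / (a ^ 2 * s)) ^ p * (a * s ^ 2)) ^ p⁻¹ with hw₀
    set w₁ : Ω → ℝ≥0∞ := fun ω => (∑ i, w i ω ^ p) ^ p⁻¹ with hw₁
    have hw₀m : Measurable w₀ := by fun_prop
    have hw₁m : Measurable w₁ := by fun_prop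
    have hpow : ∀ t : ℝ≥0∞, (t ^ p⁻¹) ^ p = t := fun t => ENNReal.rpow_inv_rpow p0.ne' t
    have hDp : ∫⁻ ω, ENNReal.ofReal (D ω ^ p) ∂P ≤ ENNReal.ofReal ((2 * s * G) ^ p) := by
      have h1 : ∀ ω, ENNReal.ofReal (D ω ^ p) ≤ 4 ^ (p - 1) * ∑ i, ENNReal.ofReal
          (|(μ ω).real (quarter x y s i) - ∫ z in quarter x y s i, f z| ^ p) := fun ω => by
        rw [← ENNReal.ofReal_rpow_of_nonneg (hD0 ω) p0.le, hD,
          ENNReal.ofReal_sum_of_nonneg fun i _ => abs_nonneg _]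
        refine (ENNReal.rpow_sum_le_const_mul_sum_rpow _ _ hp).trans (le_of_eq ?_)
        congr 1
        exact Finset.sum_congr rfl fun i _ => ENNReal.ofReal_rpow_of_nonneg (abs_nonneg _) p0.le
      refine (lintegral_mono h1).trans ?_
      have hmi : ∀ i, Measurable fun ω => ENNReal.ofReal
          (|(μ ω).real (quarter x y s i) - ∫ z in quarter x y s i, f z| ^ p) := fun i =>
        ((((hmeas _ (measurableSet_quarter x y s i)).ennreal_toReal).sub_const _).abs.pow_const
          _).ennreal_ofReal
      rw [lintegral_const_mul _ (Finset.measurable_sum _ fun i _ => hmi i),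
        lintegral_finsetSum _ fun i _ => hmi i]
      calc _ ≤ 4 ^ (p - 1) * ∑ i : Bool × Bool, ENNReal.ofReal ((s / 2) ^ p * G ^ p) := by
            gcongr with i
            exact hmom _ _ _ hs2 (hsub i)
        _ = ENNReal.ofReal (4 ^ (p - 1) * (4 * ((s / 2) ^ p * G ^ p))) := by
            have : (Finset.univ : Finset (Bool × Bool)).card = 4 := rfl
            rw [Finset.sum_const, ENNReal.ofReal_mul (by positivity : (0:ℝ) ≤ 4 ^ (p - 1)),
              ENNReal.ofReal_mul (by norm_num : (0:ℝ) ≤ 4),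
              ← ENNReal.ofReal_rpow_of_pos (by norm_num : (0:ℝ) < 4), this, nsmul_eq_mul,
              ENNReal.ofReal_ofNat]
            rfl
        _ = ENNReal.ofReal ((2 * s * G) ^ p) := by
            congr 1
            have : 2 * s * G = 4 * ((s / 2) * G) := by ring
            rw [this, Real.mul_rpow (by norm_num) (by positivity),
              Real.mul_rpow (by positivity) hG0.le, ← mul_assoc, Real.rpow_sub_one (by norm_num)]
            ring
    set κ := (A / a ^ 2) ^ p * a * s ^ 2 with hκ
    have hκ0 : 0 ≤ κ := by positivity
    have hi₀ : ∫⁻ ω, w₀ ω ^ p ∂P ≤ ENNReal.ofReal κ * ENNReal.ofReal (160 * G) ^ p := by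
      simp only [hw₀, hpow]
      have : ∀ ω, ENNReal.ofReal ((80 * A * D ω / (a ^ 2 * s)) ^ p * (a * s ^ 2)) =
          ENNReal.ofReal ((80 * A / (a ^ 2 * s)) ^ p * (a * s ^ 2)) *
            ENNReal.ofReal (D ω ^ p) := fun ω => by
        rw [← ENNReal.ofReal_mul (by positivity), mul_div_right_comm,
          Real.mul_rpow (by positivity) (hD0 ω)]
        congr 1; ring
      simp only [this]
      rw [lintegral_const_mul _ (by fun_prop)]
      refine (mul_le_mul_right hDp _).trans (le_of_eq ?_)
      rw [ENNReal.ofReal_rpow_of_nonneg (by positivity) p0.le, ← ENNReal.ofReal_mul (by positivity),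
        ← ENNReal.ofReal_mul hκ0]
      congr 1
      have e1 : (80 * A / (a ^ 2 * s)) ^ p * (2 * s * G) ^ p =
          (A / a ^ 2) ^ p * (160 * G) ^ p := by
        rw [← Real.mul_rpow (by positivity) (by positivity),
          ← Real.mul_rpow (by positivity) (by positivity)]
        congr 1; field_simp; norm_num
      calc _ = ((80 * A / (a ^ 2 * s)) ^ p * (2 * s * G) ^ p) * (a * s ^ 2) := by ring
        _ = _ := by rw [e1, hκ]; ring
    have hi₁ : ∫⁻ ω, w₁ ω ^ p ∂P ≤ ENNReal.ofReal κ * ENNReal.ofReal U ^ p := by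
      simp only [hw₁, hpow]
      rw [lintegral_finsetSum _ fun i _ => (hwm i).pow_const _]
      refine (Finset.sum_le_sum fun i _ => hwi i).trans (le_of_eq ?_)
      rw [Finset.sum_const, nsmul_eq_mul, ← mul_assoc]
      congr 1
      have : (Finset.univ : Finset (Bool × Bool)).card = 4 := rfl
      rw [this, ← ENNReal.ofReal_natCast, ← ENNReal.ofReal_mul (by positivity)]
      congr 1
      rw [hκ]; push_cast; ring
    refine ⟨w₁ + w₀, hw₁m.add hw₀m, fun ω => ?_, ?_⟩
    · have c1 := CoupledWithin.sum Finset.univ fun i _ => hwc i ω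
      change CoupledWithin p (∑ i, (μ ω).restrict (quarter x y s i)) (∑ i, rescaledRestrict
        (volume.withDensity fun z => ENNReal.ofReal (f z)) (μ ω) (quarter x y s i)) _ at c1
      rw [← restrict_eq_sum_quarter hs.le, ← hpow (∑ i, w i ω ^ p)] at c1
      have c2 := coupledWithin_quarter hp hf ha ha1 hA hb (μ ω) x y hs (D := D ω) rfl
      rw [← hpow (ENNReal.ofReal _)] at c2
      exact c1.trans hp c2
    · rw [hU', ENNReal.ofReal_add hU0 (by positivity)]
      have mk := ENNReal.lintegral_Lp_add_le (μ := P) hw₁m.aemeasurable hw₀m.aemeasurable hp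
      rw [one_div] at mk
      have hip : 0 ≤ p⁻¹ := inv_nonneg.2 p0.le
      have hfac : ∀ t : ℝ≥0∞, (ENNReal.ofReal κ * t ^ p) ^ p⁻¹ = ENNReal.ofReal κ ^ p⁻¹ * t :=
        fun t => by rw [ENNReal.mul_rpow_of_nonneg _ _ hip, ENNReal.rpow_rpow_inv p0.ne']
      have hsplit : ∀ u v : ℝ≥0∞, ENNReal.ofReal κ * (u + v) ^ p =
          (ENNReal.ofReal κ ^ p⁻¹ * u + ENNReal.ofReal κ ^ p⁻¹ * v) ^ p := fun u v => by
        rw [← mul_add, ENNReal.mul_rpow_of_nonneg _ _ p0.le, hpow]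
      rw [hsplit, ← ENNReal.rpow_inv_le_iff p0, ← hfac, ← hfac]
      exact mk.trans (add_le_add (ENNReal.rpow_le_rpow hi₁ hip) (ENNReal.rpow_le_rpow hi₀ hip))

/-- The closed axis-parallel square with lower left corner `(x, y)` and side `s`. -/
def closedSquare (x y s : ℝ) : Set (ℝ × ℝ) := Set.Icc x (x + s) ×ˢ Set.Icc y (y + s)

theorem measurableSet_closedSquare (x y s : ℝ) : MeasurableSet (closedSquare x y s) :=
  measurableSet_Icc.prod measurableSet_Icc

theorem volume_closedSquare (x y : ℝ) {s : ℝ} (hs : 0 ≤ s) :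
    volume (closedSquare x y s) = ENNReal.ofReal (s ^ 2) := by
  rw [closedSquare, Measure.volume_eq_prod, Measure.prod_prod, Real.volume_Icc, Real.volume_Icc,
    ← ENNReal.ofReal_mul (by linarith)]
  congr 1; ring

theorem closedBall_eq_closedSquare (z : ℝ × ℝ) (r : ℝ) :
    Metric.closedBall z r = closedSquare (z.1 - r) (z.2 - r) (2 * r) := by
  rw [← closedBall_prod_same, Real.closedBall_eq_Icc, Real.closedBall_eq_Icc, closedSquare]
  congr 2 <;> ring

theorem halfOpenSquare_subset_closedSquare (x y s : ℝ) :
    halfOpenSquare x y s ⊆ closedSquare x y s :=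
  Set.prod_mono Set.Ico_subset_Icc_self Set.Ico_subset_Icc_self

theorem halfOpenSquare_ae_eq_closedSquare (x y : ℝ) {s : ℝ} (hs : 0 ≤ s) :
    halfOpenSquare x y s =ᵐ[volume] closedSquare x y s :=
  ae_eq_of_subset_of_measure_ge (halfOpenSquare_subset_closedSquare x y s)
    (by rw [volume_closedSquare x y hs, volume_halfOpenSquare x y hs])
    (measurableSet_halfOpenSquare x y s).nullMeasurableSet
    (by rw [volume_closedSquare x y hs]; exact ofReal_ne_top)

theorem closedSquare_subset_iff {x y s S : ℝ} (hs : 0 ≤ s) :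
    closedSquare x y s ⊆ closedSquare 0 0 S ↔ (0 ≤ x ∧ x + s ≤ S) ∧ 0 ≤ y ∧ y + s ≤ S := by
  simp only [closedSquare, zero_add]
  rw [Set.prod_subset_prod_iff, Set.Icc_subset_Icc_iff (by linarith),
    Set.Icc_subset_Icc_iff (by linarith)]
  simp [Set.Icc_eq_empty_iff, hs]

/-- A small square centred at a point of a bigger one can be moved inside it without losing any
common point. -/
theorem exists_closedSquare_superset {S r : ℝ} (hr : 0 ≤ r) (hrS : 2 * r ≤ S) {z : ℝ × ℝ}
    (hz : z ∈ closedSquare 0 0 S) : ∃ x y, closedSquare x y (2 * r) ⊆ closedSquare 0 0 S ∧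
      Metric.closedBall z r ∩ closedSquare 0 0 S ⊆ closedSquare x y (2 * r) := by
  have aux : ∀ t ∈ Set.Icc 0 S, ∃ u, (0 ≤ u ∧ u + 2 * r ≤ S) ∧
      ∀ v ∈ Set.Icc (t - r) (t - r + 2 * r), v ∈ Set.Icc 0 S → v ∈ Set.Icc u (u + 2 * r) := by
    rintro t ⟨h0, hS⟩
    refine ⟨max 0 (min (t - r) (S - 2 * r)), ⟨le_max_left _ _, ?_⟩, ?_⟩
    · have : max 0 (min (t - r) (S - 2 * r)) ≤ S - 2 * r :=
        max_le (by linarith) (min_le_right _ _)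
      linarith
    · rintro v ⟨h1, h2⟩ ⟨h3, h4⟩
      refine ⟨max_le h3 ((min_le_left _ _).trans h1), ?_⟩
      rcases min_choice (t - r) (S - 2 * r) with h | h <;> rw [h]
      · linarith [le_max_right 0 (t - r)]
      · linarith [le_max_right 0 (S - 2 * r)]
  simp only [closedSquare, zero_add, Set.mem_prod] at hz
  obtain ⟨x, hx, hx'⟩ := aux z.1 hz.1
  obtain ⟨y, hy, hy'⟩ := aux z.2 hz.2
  refine ⟨x, y, (closedSquare_subset_iff (by linarith)).2 ⟨hx, hy⟩, ?_⟩
  rw [closedBall_eq_closedSquare]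
  rintro v ⟨⟨h1, h2⟩, h3, h4⟩
  rw [zero_add] at h3 h4
  exact ⟨hx' _ h1 h3, hy' _ h2 h4⟩

/-- A measure on a square comparable to area on all subsquares has a bounded density. -/
theorem exists_density {M : Measure (ℝ × ℝ)} [IsFiniteMeasure M] {S a A : ℝ} (hS : 0 < S)
    (ha : 0 < a) (haA : a ≤ A) (hM : M (closedSquare 0 0 S)ᶜ = 0)
    (hd : ∀ x y s, 0 ≤ s → closedSquare x y s ⊆ closedSquare 0 0 S →
      ENNReal.ofReal (a * s ^ 2) ≤ M (closedSquare x y s) ∧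
        M (closedSquare x y s) ≤ ENNReal.ofReal (A * s ^ 2)) :
    ∃ f : ℝ × ℝ → ℝ, Measurable f ∧ (∀ z, f z ∈ Set.Icc a A) ∧
      M = (volume.restrict (closedSquare 0 0 S)).withDensity fun z => ENNReal.ofReal (f z) := by
  have hA : 0 < A := ha.trans_le haA
  have hQm := measurableSet_closedSquare 0 0 S
  have hsmall : ∀ᶠ r in nhdsWithin (0 : ℝ) (Set.Ioi 0), 0 < r ∧ 2 * r ≤ S := by
    filter_upwards [Ioo_mem_nhdsGT (show (0 : ℝ) < S / 2 by positivity)] with r hr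
    exact ⟨hr.1, by linarith [hr.2]⟩
  have hup : ∀ z ∈ closedSquare 0 0 S, ∀ r, 0 < r → 2 * r ≤ S →
      M (Metric.closedBall z r) ≤ ENNReal.ofReal A * volume (Metric.closedBall z r) := by
    intro z hz r hr hrS
    obtain ⟨x, y, h1, h2⟩ := exists_closedSquare_superset hr.le hrS hz
    have hball : M (Metric.closedBall z r) ≤ M (Metric.closedBall z r ∩ closedSquare 0 0 S) := by
      rw [measure_inter_conull hM]
    refine hball.trans ((measure_mono h2).trans ((hd x y _ (by linarith) h1).2.trans ?_))
    rw [closedBall_eq_closedSquare, volume_closedSquare _ _ (by linarith),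
      ENNReal.ofReal_mul hA.le]
  have hmem : ∀ᵐ z ∂M, z ∈ closedSquare 0 0 S := hM
  have hvol : ∀ (z : ℝ × ℝ) r, 0 < r → volume (Metric.closedBall z r) ≠ 0 := fun z r hr => by
    rw [closedBall_eq_closedSquare, volume_closedSquare _ _ (by linarith)]
    simp; positivity
  have hvol' : ∀ (z : ℝ × ℝ) r, volume (Metric.closedBall z r) ≠ ∞ := fun z r =>
    (isCompact_closedBall z r).measure_lt_top.ne
  have hac : M ≪ volume := by
    have hpos : ∀ᵐ z ∂M, 0 < (volume : Measure (ℝ × ℝ)).rnDeriv M z := by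
      filter_upwards [Besicovitch.ae_tendsto_rnDeriv volume M, hmem] with z hz hzQ
      refine lt_of_lt_of_le (b := (ENNReal.ofReal A)⁻¹) (by simp) (ge_of_tendsto hz ?_)
      filter_upwards [hsmall] with r hr
      rw [ENNReal.le_div_iff_mul_le (Or.inr (hvol z r hr.1)) (Or.inl (measure_ne_top _ _)),
        mul_comm, ← div_eq_mul_inv]
      exact ENNReal.div_le_of_le_mul' (hup z hzQ r hr.1 hr.2)
    intro s hs
    have h0 : ∫⁻ z in s, (volume : Measure (ℝ × ℝ)).rnDeriv M z ∂M = 0 :=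
      le_antisymm ((Measure.setLIntegral_rnDeriv_le s).trans hs.le) zero_le
    rw [lintegral_eq_zero_iff (Measure.measurable_rnDeriv _ _)] at h0
    have h1 : ∀ᵐ z ∂M.restrict s, False := by
      filter_upwards [h0, ae_restrict_of_ae hpos] with z h2 h3
      exact h3.ne' h2
    simpa using h1
  set h := M.rnDeriv volume with hh
  have hup' : ∀ᵐ z, z ∈ closedSquare 0 0 S → h z ≤ ENNReal.ofReal A := by
    filter_upwards [Besicovitch.ae_tendsto_rnDeriv M volume] with z hz hzQ
    refine le_of_tendsto hz ?_
    filter_upwards [hsmall] with r hr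
    exact ENNReal.div_le_of_le_mul (hup z hzQ r hr.1 hr.2)
  have hlo : ∀ᵐ z, z ∈ Set.Ioo 0 S ×ˢ Set.Ioo 0 S → ENNReal.ofReal a ≤ h z := by
    filter_upwards [Besicovitch.ae_tendsto_rnDeriv M volume] with z hz hzQ
    obtain ⟨⟨h1, h2⟩, h3, h4⟩ := hzQ
    refine ge_of_tendsto hz ?_
    filter_upwards [hsmall, Ioo_mem_nhdsGT h1, Ioo_mem_nhdsGT h3, Ioo_mem_nhdsGT (sub_pos.2 h2),
      Ioo_mem_nhdsGT (sub_pos.2 h4)] with r hr h1 h3 h2 h4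
    have hr2 : 0 ≤ 2 * r := by linarith
    rw [ENNReal.le_div_iff_mul_le (Or.inl (hvol z r hr.1)) (Or.inl (hvol' z r)),
      closedBall_eq_closedSquare, volume_closedSquare _ _ hr2, ← ENNReal.ofReal_mul ha.le]
    exact (hd _ _ _ hr2 ((closedSquare_subset_iff hr2).2
      ⟨⟨by linarith [h1.2], by linarith [h2.2]⟩, by linarith [h3.2], by linarith [h4.2]⟩)).1
  have hIoo : (Set.Ioo 0 S ×ˢ Set.Ioo 0 S : Set (ℝ × ℝ)) =ᵐ[volume] closedSquare 0 0 S := by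
    rw [closedSquare, zero_add]
    exact Measure.set_prod_ae_eq Ioo_ae_eq_Icc Ioo_ae_eq_Icc
  have hmeas : Measurable h := Measure.measurable_rnDeriv _ _
  refine ⟨fun z => max a (min A (h z).toReal), by fun_prop,
    fun z => ⟨le_max_left _ _, max_le haA (min_le_left _ _)⟩, ?_⟩
  calc M = M.restrict (closedSquare 0 0 S) := (Measure.restrict_eq_self_of_ae_mem hM).symm
    _ = (volume.restrict (closedSquare 0 0 S)).withDensity h := by
      rw [← restrict_withDensity hQm, Measure.withDensity_rnDeriv_eq _ _ hac]
    _ = _ := by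
      rw [← Measure.restrict_congr_set hIoo]
      refine withDensity_congr_ae ?_
      filter_upwards [ae_restrict_mem (measurableSet_Ioo.prod measurableSet_Ioo),
        ae_restrict_of_ae hlo, ae_restrict_of_ae hup'] with z hz hz1 hz2
      have h1 := hz1 hz
      have h2 := hz2 (by
        rw [closedSquare, zero_add]
        exact Set.prod_mono Set.Ioo_subset_Icc_self Set.Ioo_subset_Icc_self hz)
      have h3 : h z ≠ ∞ := ne_top_of_le_ne_top ofReal_ne_top h2
      rw [min_eq_right (ENNReal.toReal_le_of_le_ofReal hA.le h2),
        max_eq_right ((ENNReal.ofReal_le_iff_le_toReal h3).1 h1), ENNReal.ofReal_toReal h3]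

theorem one_le_log_four : 1 ≤ Real.log 4 := by
  have : (4 : ℝ) = 2 ^ 2 := by norm_num
  rw [this, Real.log_pow]
  have := Real.log_two_gt_d9
  push_cast; linarith

theorem intervalIntegrable_div_of_monotone {g : ℝ → ℝ}
    (hm : MonotoneOn g (Set.Ici 1) ∨ AntitoneOn g (Set.Ici 1)) {u v : ℝ} (hu : 1 ≤ u) (hv : 1 ≤ v) :
    IntervalIntegrable (fun y => g y / y) volume u v := by
  have hsub : Set.uIcc u v ⊆ Set.Ici 1 := fun t ht => (le_min hu hv).trans ht.1
  have hi : IntervalIntegrable g volume u v := by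
    rcases hm with hm | hm
    · exact (hm.mono hsub).intervalIntegrable
    · exact (hm.mono hsub).intervalIntegrable
  simp only [div_eq_mul_inv]
  refine hi.mul_continuousOn (continuousOn_inv₀.mono fun t ht => ?_)
  have : (1 : ℝ) ≤ t := hsub ht
  simp; linarith

/-- A lower bound for `g` on an interval of ratio four is controlled by the integral of `g y / y`. -/
theorem le_integral_div {g : ℝ → ℝ}
    (hm : MonotoneOn g (Set.Ici 1) ∨ AntitoneOn g (Set.Ici 1)) {u c : ℝ} (hu : 1 ≤ u) (hc : 0 ≤ c)
    (hgc : ∀ y ∈ Set.Icc u (4 * u), c ≤ g y) : c ≤ ∫ y in u..(4 * u), g y / y := by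
  have h1 : ∫ y in u..(4 * u), c / y = c * Real.log 4 := by
    simp only [div_eq_mul_inv]
    rw [intervalIntegral.integral_const_mul, integral_inv_of_pos (by linarith) (by linarith)]
    congr 2; field_simp
  have hi : IntervalIntegrable (fun y => c / y) volume u (4 * u) :=
    intervalIntegrable_div_of_monotone (g := fun _ => c) (Or.inl monotoneOn_const) hu (by linarith)
  calc c ≤ c * Real.log 4 := le_mul_of_one_le_right hc one_le_log_four
    _ = ∫ y in u..(4 * u), c / y := h1.symm
    _ ≤ _ := intervalIntegral.integral_mono_on (by linarith) hi
      (intervalIntegrable_div_of_monotone hm hu (by linarith)) fun y hy =>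
        div_le_div_of_nonneg_right (hgc y hy) (by linarith [hy.1])

/-- The values of a monotone function along a geometric progression are controlled by its
integral against `dy / y`. -/
theorem sum_geometric_le_integral {g : ℝ → ℝ} (hg : ∀ t, 1 ≤ t → 0 < g t)
    (hm : MonotoneOn g (Set.Ici 1) ∨ AntitoneOn g (Set.Ici 1)) {N : ℝ} {n : ℕ}
    (hN : 4 ^ (n + 1) ≤ N) :
    ∑ j ∈ Finset.range n, g (N / 4 ^ (j + 1)) ≤ ∫ y in (1 : ℝ)..N, g y / y := by
  have hN1 : 1 ≤ N := (one_le_pow₀ (by norm_num)).trans hN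
  have hk : ∀ k ≤ n + 1, 1 ≤ N / 4 ^ k := fun k hk => by
    rw [le_div_iff₀ (by positivity), one_mul]
    exact (pow_le_pow_right₀ (by norm_num) hk).trans hN
  have hstep : ∀ k, N / 4 ^ k = 4 * (N / 4 ^ (k + 1)) := fun k => by
    rw [pow_succ]; field_simp
  have hmono : ∀ u v, 1 ≤ u → u ≤ v → v ≤ N →
      ∫ y in u..v, g y / y ≤ ∫ y in (1 : ℝ)..N, g y / y := fun u v hu huv hv => by
    refine intervalIntegral.integral_mono_interval hu huv hv ?_
      (intervalIntegrable_div_of_monotone hm le_rfl hN1)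
    filter_upwards [ae_restrict_mem measurableSet_Ioc] with y hy
    exact div_nonneg (hg y hy.1.le).le (by linarith [hy.1])
  have hsum : ∀ i, i ≤ 1 → ∑ j ∈ Finset.range n, g (N / 4 ^ (j + 1)) ≤
      ∑ j ∈ Finset.range n, ∫ y in (N / 4 ^ (j + i + 1))..(N / 4 ^ (j + i)), g y / y →
      ∑ j ∈ Finset.range n, g (N / 4 ^ (j + 1)) ≤ ∫ y in (1 : ℝ)..N, g y / y := fun i hi h => by
    refine h.trans ?_
    have h1 : ∀ j ∈ Finset.range n, ∫ y in (N / 4 ^ (j + i + 1))..(N / 4 ^ (j + i)), g y / y =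
        -∫ y in (N / 4 ^ (j + i))..(N / 4 ^ (j + 1 + i)), g y / y := fun j _ => by
      rw [intervalIntegral.integral_symm, add_right_comm]
    rw [Finset.sum_congr rfl h1, Finset.sum_neg_distrib,
      intervalIntegral.sum_integral_adjacent_intervals (a := fun k => N / 4 ^ (k + i))
        fun k hkn => intervalIntegrable_div_of_monotone hm (hk _ (by omega)) (hk _ (by omega)),
      ← intervalIntegral.integral_symm]
    refine hmono _ _ (hk _ (by omega)) ?_ (div_le_self (by linarith) (one_le_pow₀ (by norm_num)))
    gcongr
    · norm_num
    · omega
  rcases id hm with hm' | hm'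
  · refine hsum 0 zero_le_one (Finset.sum_le_sum fun j hj => ?_)
    have hj' := Finset.mem_range.1 hj
    have h1 := hk (j + 1) (by omega)
    rw [add_zero, hstep j]
    exact le_integral_div hm h1 (hg _ h1).le fun y hy => hm' h1 (h1.trans hy.1) hy.1
  · refine hsum 1 le_rfl (Finset.sum_le_sum fun j hj => ?_)
    have hj' := Finset.mem_range.1 hj
    have h1 := hk (j + 1) (by omega)
    have h2 := hk (j + 1 + 1) (by omega)
    conv_rhs => rw [hstep (j + 1)]
    refine le_integral_div hm h2 (hg _ h1).le fun y hy => hm' (h2.trans hy.1) h1 ?_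
    rw [hstep (j + 1)]; exact hy.2

/-- A choice of the number of dyadic scales for a square of area `N`. -/
theorem exists_scale (N : ℝ) : ∃ n : ℕ, Real.sqrt N ≤ 4 * 2 ^ n ∧
    (n ≠ 0 → 4 ^ (n + 1) ≤ N) := by
  have h4 : ∀ k : ℕ, (4 : ℝ) ^ k = (2 ^ k) ^ 2 := fun k => by
    rw [← pow_mul, mul_comm, pow_mul]; norm_num
  rcases lt_or_ge N 16 with h | h
  · refine ⟨0, ?_, fun h => absurd rfl h⟩
    rw [Real.sqrt_le_left (by norm_num)]
    norm_num; exact h.le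
  · obtain ⟨k, hk1, hk2⟩ := exists_nat_pow_near (show 1 ≤ N by linarith) (show (1 : ℝ) < 4 by norm_num)
    have hk : 1 ≤ k := by
      by_contra hk
      have : k = 0 := by omega
      subst this
      norm_num at hk2; linarith
    obtain ⟨n, rfl⟩ := Nat.exists_eq_add_of_le' hk
    refine ⟨n, ?_, fun _ => hk1⟩
    rw [Real.sqrt_le_left (by positivity), mul_pow, ← h4]
    rw [pow_succ, pow_succ] at hk2
    linarith

theorem exists_coupling_closedSquare {p : ℝ} (hp : 1 ≤ p) {N : ℝ} (hN : 0 < N) {Ω : Type*}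
    [MeasurableSpace Ω] (P : Measure Ω) (μ : Ω → Measure (ℝ × ℝ))
    (hfin : ∀ ω, IsFiniteMeasure (μ ω))
    (hcar : ∀ ω, μ ω (closedSquare 0 0 (Real.sqrt N))ᶜ = 0)
    (hmeas : ∀ B, MeasurableSet B → Measurable fun ω => μ ω B) (M : Measure (ℝ × ℝ))
    (hM : ∀ B, MeasurableSet B → M B = ∫⁻ ω, μ ω B ∂P)
    (g : ℝ → ℝ) (hg : ∀ t, 1 ≤ t → 0 < g t)
    (hm : MonotoneOn g (Set.Ici 1) ∨ AntitoneOn g (Set.Ici 1))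
    (hmom : ∀ x y s, 1 ≤ s → closedSquare x y s ⊆ closedSquare 0 0 (Real.sqrt N) →
      ∫⁻ ω, ENNReal.ofReal (|(μ ω).real (closedSquare x y s) - M.real (closedSquare x y s)| ^ p) ∂P
        ≤ ENNReal.ofReal (s ^ p * g (s ^ 2) ^ p))
    {a A : ℝ} (ha : 0 < a) (ha1 : a ≤ 1) (hA : 1 ≤ A)
    (hd : ∀ x y s, 0 ≤ s → closedSquare x y s ⊆ closedSquare 0 0 (Real.sqrt N) →
      ENNReal.ofReal (a * s ^ 2) ≤ M (closedSquare x y s) ∧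
        M (closedSquare x y s) ≤ ENNReal.ofReal (A * s ^ 2)) :
    ∃ K : Ω → ℝ≥0∞, (∀ᵐ ω ∂P, CoupledWithin p (μ ω)
        ((μ ω (closedSquare 0 0 (Real.sqrt N)) / M (closedSquare 0 0 (Real.sqrt N))) • M) (K ω)) ∧
      ∫⁻ ω, K ω ∂P ≤ ENNReal.ofReal (a ^ (1 - 2 * p) * A ^ p * N *
        (160 * (1 + ∫ y in (1 : ℝ)..(max 1 N), g y / y)) ^ p) := by
  have p0 : 0 < p := by linarith
  set S := Real.sqrt N with hSdef
  have hS : 0 < S := Real.sqrt_pos.2 hN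
  have hS2 : S ^ 2 = N := Real.sq_sqrt hN.le
  set Q := closedSquare 0 0 S with hQ
  set Q' := halfOpenSquare 0 0 S with hQ'
  have hQm : MeasurableSet Q := measurableSet_closedSquare _ _ _
  have hQm' : MeasurableSet Q' := measurableSet_halfOpenSquare _ _ _
  have hMcar : M Qᶜ = 0 := by rw [hM _ hQm.compl]; simp [hcar]
  have hMfin : IsFiniteMeasure M := ⟨by
    rw [← measure_inter_conull hMcar, Set.univ_inter]
    exact ((hd 0 0 S hS.le subset_rfl).2).trans_lt ofReal_lt_top⟩
  obtain ⟨f, hf, hb, hMf⟩ := exists_density hS ha (ha1.trans hA) hMcar hd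
  have hf0 : ∀ z, 0 ≤ f z := fun z => ha.le.trans (hb z).1
  set E := volume.withDensity fun z => ENNReal.ofReal (f z) with hE
  have hME : M = E.restrict Q := by rw [hMf, hE, restrict_withDensity hQm]
  have hac : M ≪ volume := by
    rw [hME]; exact Measure.restrict_le_self.absolutelyContinuous.trans
      (withDensity_absolutelyContinuous _ _)
  have hMae : ∀ x y s, 0 ≤ s → M (closedSquare x y s \ halfOpenSquare x y s) = 0 :=
    fun x y s hs => hac (ae_le_set.1 (halfOpenSquare_ae_eq_closedSquare x y hs).symm.le)
  have hμae : ∀ x y s, 0 ≤ s → ∀ᵐ ω ∂P, halfOpenSquare x y s =ᵐ[μ ω] closedSquare x y s := by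
    intro x y s hs
    have hms := (measurableSet_closedSquare x y s).diff (measurableSet_halfOpenSquare x y s)
    have := hMae x y s hs
    rw [hM _ hms, lintegral_eq_zero_iff (hmeas _ hms)] at this
    filter_upwards [this] with ω hω
    exact (halfOpenSquare_subset_closedSquare x y s).eventuallyLE.antisymm (ae_le_set.2 hω)
  have hMhalf : ∀ x y s, 0 ≤ s → M (halfOpenSquare x y s) = M (closedSquare x y s) :=
    fun x y s hs => measure_congr
      ((halfOpenSquare_subset_closedSquare x y s).eventuallyLE.antisymm (ae_le_set.2 (hMae x y s hs)))
  have hMint : ∀ x y s, halfOpenSquare x y s ⊆ Q' →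
      M (halfOpenSquare x y s) = ENNReal.ofReal (∫ z in halfOpenSquare x y s, f z) := by
    intro x y s hsub
    have hsm := measurableSet_halfOpenSquare x y s
    have hi : IntegrableOn f (halfOpenSquare x y s) :=
      integrableOn_halfOpenSquare (C := A) hf
        (fun z => by rw [abs_of_nonneg (hf0 z)]; exact (hb z).2) x y s
    rw [hME, Measure.restrict_apply hsm, Set.inter_eq_left.2
      (hsub.trans (halfOpenSquare_subset_closedSquare 0 0 S)), hE, withDensity_apply _ hsm,
      ofReal_integral_eq_lintegral_ofReal hi (Filter.Eventually.of_forall hf0)]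
  have hclosed : ∀ x y s, 0 < s → halfOpenSquare x y s ⊆ Q' → closedSquare x y s ⊆ Q := by
    intro x y s hs hsub
    have h1 := closure_mono hsub
    simp only [hQ', halfOpenSquare, closure_prod_eq] at h1
    rwa [closure_Ico (by linarith), closure_Ico (by linarith), closure_Ico (by linarith)] at h1
  obtain ⟨n, hn1, hn2⟩ := exists_scale N
  obtain ⟨w, hwm, hwc, hwi⟩ := exists_multiscale_coupling hp hf ha ha1 hA hb P μ hfin hmeas Q'
    (fun x y s _ hsub => by
      rw [← hMint x y s hsub, hM _ (measurableSet_halfOpenSquare x y s)]) g hg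
    (fun x y s hs hsub => by
      have hs0 : 0 ≤ s := by linarith
      refine le_trans (le_of_eq (lintegral_congr_ae ?_))
        (hmom x y s hs (hclosed x y s (by linarith) hsub))
      filter_upwards [hμae x y s hs0] with ω hω
      have h1 : M.real (closedSquare x y s) = ∫ z in halfOpenSquare x y s, f z := by
        rw [Measure.real, ← hMhalf x y s hs0, hMint x y s hsub,
          ENNReal.toReal_ofReal (integral_nonneg hf0)]
      rw [h1, measureReal_congr hω])
    n 0 0 S hS hn1 (fun h => by
      rw [Real.le_sqrt' (by positivity), ← pow_mul, mul_comm, pow_mul]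
      refine le_trans ?_ (hn2 h)
      have h22 : (2 : ℝ) ^ 2 = 4 := by norm_num
      rw [h22, pow_succ]
      linarith [pow_pos (show (0 : ℝ) < 4 by norm_num) n]) subset_rfl
  refine ⟨fun ω => w ω ^ p, ?_, hwi.trans ?_⟩
  · filter_upwards [hμae 0 0 S hS.le] with ω hω
    have h1 : (μ ω).restrict Q' = μ ω := by
      rw [Measure.restrict_congr_set hω]
      exact Measure.restrict_eq_self_of_ae_mem (hcar ω)
    have h2 : E.restrict Q' = M := by
      rw [hME]
      exact Measure.restrict_congr_set ((withDensity_absolutelyContinuous _ _).ae_eq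
        (halfOpenSquare_ae_eq_closedSquare 0 0 hS.le))
    have h3 : E Q' = M Q := by
      rw [← Measure.restrict_apply_univ, h2, ← measure_inter_conull hMcar, Set.univ_inter]
    have := hwc ω
    rwa [rescaledRestrict, h1, h2, h3, measure_congr hω] at this
  · have hI0 : 0 ≤ ∫ y in (1 : ℝ)..(max 1 N), g y / y :=
      intervalIntegral.integral_nonneg (le_max_left _ _) fun y hy =>
        div_nonneg (hg y hy.1).le (by linarith [hy.1])
    have hsum : ∑ j ∈ Finset.range n, g (S ^ 2 / 4 ^ (j + 1)) ≤
        ∫ y in (1 : ℝ)..(max 1 N), g y / y := by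
      rcases eq_or_ne n 0 with rfl | h
      · simpa using hI0
      · have h1 : 1 ≤ N := (one_le_pow₀ (by norm_num)).trans (hn2 h)
        rw [hS2, max_eq_right h1]
        exact sum_geometric_le_integral hg hm (hn2 h)
    have hle : 4 + ∑ j ∈ Finset.range n, 160 * g (S ^ 2 / 4 ^ (j + 1)) ≤
        160 * (1 + ∫ y in (1 : ℝ)..(max 1 N), g y / y) := by
      rw [← Finset.mul_sum]; linarith
    have hconst : (A / a ^ 2) ^ p * a * S ^ 2 = a ^ (1 - 2 * p) * A ^ p * N := by
      rw [hS2, Real.div_rpow (by linarith) (by positivity), ← Real.rpow_natCast, ← Real.rpow_mul ha.le,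
        Real.rpow_sub ha, Real.rpow_one]
      push_cast; ring
    rw [hconst, ENNReal.ofReal_mul (by positivity : 0 ≤ a ^ (1 - 2 * p) * A ^ p * N),
      ← ENNReal.ofReal_rpow_of_nonneg (by positivity) p0.le]
    gcongr

theorem CoupledWithin.wpPow_le {d : ℕ} {p : ℝ} {μ ν : Measure (EuclideanSpace ℝ (Fin d))}
    {K : ℝ≥0∞} (h : CoupledWithin p μ ν K) : WpPow p μ ν ≤ K := by
  obtain ⟨π, h1, h2, h3⟩ := h
  exact (iInf₂_le π ⟨h1, h2⟩).trans h3

/-- Lipschitz images of coupled measures are coupled. -/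
theorem CoupledWithin.map {X Y : Type*} [MeasurableSpace X] [PseudoEMetricSpace X]
    [MeasurableSpace Y] [PseudoEMetricSpace Y] [BorelSpace Y] [SecondCountableTopology Y]
    {p : ℝ} (hp : 0 ≤ p) {μ ν : Measure X} {K : ℝ≥0∞} (h : CoupledWithin p μ ν K) {T : X → Y}
    (hT : Measurable T) {L : NNReal} (hL : LipschitzWith L T) :
    CoupledWithin p (μ.map T) (ν.map T) ((L : ℝ≥0∞) ^ p * K) := by
  obtain ⟨π, rfl, rfl, h3⟩ := h
  have hm : Measurable (Prod.map T T) := hT.prodMap hT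
  refine ⟨π.map (Prod.map T T), ?_, ?_, ?_⟩
  · rw [Measure.map_map measurable_fst hm, Measure.map_map hT measurable_fst]; rfl
  · rw [Measure.map_map measurable_snd hm, Measure.map_map hT measurable_snd]; rfl
  · rw [lintegral_map (by fun_prop) hm]
    calc _ ≤ ∫⁻ z, (L : ℝ≥0∞) ^ p * edist z.1 z.2 ^ p ∂π := by
          refine lintegral_mono fun z => ?_
          rw [← ENNReal.mul_rpow_of_nonneg _ _ hp]
          exact ENNReal.rpow_le_rpow (hL z.1 z.2) hp
      _ = (L : ℝ≥0∞) ^ p * ∫⁻ z, edist z.1 z.2 ^ p ∂π :=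
          lintegral_const_mul' _ _ (ENNReal.rpow_ne_top_of_nonneg hp ENNReal.coe_ne_top)
      _ ≤ _ := by gcongr

/-- The Euclidean plane as a product of two lines. -/
def euclideanPlaneEquiv : EuclideanSpace ℝ (Fin 2) ≃ᵐ ℝ × ℝ :=
  (MeasurableEquiv.toLp 2 (Fin 2 → ℝ)).symm.trans MeasurableEquiv.finTwoArrow

theorem euclideanPlaneEquiv_apply (v : EuclideanSpace ℝ (Fin 2)) :
    euclideanPlaneEquiv v = (v 0, v 1) := rfl

theorem measurePreserving_euclideanPlaneEquiv :
    MeasurePreserving euclideanPlaneEquiv volume volume :=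
  (volume_preserving_finTwoArrow ℝ).comp
    (EuclideanSpace.volume_preserving_symm_measurableEquiv_toLp (Fin 2))

theorem lipschitzWith_euclideanPlaneEquiv_symm :
    LipschitzWith 2 euclideanPlaneEquiv.symm := by
  refine LipschitzWith.of_dist_le_mul fun z w => ?_
  rw [EuclideanSpace.dist_eq, Fin.sum_univ_two]
  have h0 : dist (euclideanPlaneEquiv.symm z 0) (euclideanPlaneEquiv.symm w 0) ≤ dist z w :=
    le_max_left (dist z.1 w.1) (dist z.2 w.2)
  have h1 : dist (euclideanPlaneEquiv.symm z 1) (euclideanPlaneEquiv.symm w 1) ≤ dist z w :=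
    le_max_right (dist z.1 w.1) (dist z.2 w.2)
  rw [Real.sqrt_le_left (by positivity), mul_pow]
  have := pow_le_pow_left₀ dist_nonneg h0 2
  have := pow_le_pow_left₀ dist_nonneg h1 2
  norm_num
  nlinarith [sq_nonneg (dist z w)]

theorem preimage_closedSquare (x y s : ℝ) :
    euclideanPlaneEquiv ⁻¹' closedSquare x y s =
      {v | ∀ i, !₂[x, y] i ≤ v i ∧ v i ≤ !₂[x, y] i + s} := by
  ext v
  simp [closedSquare, euclideanPlaneEquiv_apply, Fin.forall_fin_two, and_and_and_comm]

theorem preimage_closedSquare_zero (N : ℝ) :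
    euclideanPlaneEquiv ⁻¹' closedSquare 0 0 (Real.sqrt N) = QN N := by
  ext v
  simp [closedSquare, euclideanPlaneEquiv_apply, Fin.forall_fin_two, QN, and_and_and_comm]

theorem isAxisSquare_preimage_closedSquare (x y : ℝ) {s : ℝ} (hs : 0 ≤ s) :
    IsAxisSquare (euclideanPlaneEquiv ⁻¹' closedSquare x y s) :=
  ⟨!₂[x, y], s, hs, preimage_closedSquare x y s⟩

theorem volume_preimage_closedSquare (x y : ℝ) {s : ℝ} (hs : 0 ≤ s) :
    (volume (euclideanPlaneEquiv ⁻¹' closedSquare x y s)).toReal = s ^ 2 := by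
  rw [measurePreserving_euclideanPlaneEquiv.measure_preimage_equiv, volume_closedSquare x y hs,
    ENNReal.toReal_ofReal (by positivity)]

/-- Theorem (main theorem, dimension 2): for a random finite measure `μ_N` on
`Q_N = [0,√N]²` satisfying a `p`-th moment bound `E[|μ_N(B) - E[μ_N(B)]|^p] ≤ |B|^{p/2} g(|B|)^p`
on squares of volume at least `1`, for a monotone `g`, and whose mean measure has density
between `a` and `A`, one has
`E[W_p^p(μ_N, μ̄_N)] ≤ C_p a^{1-2p} A^p N (1 + ∫_1^{max(1,N)} g(y)/y dy)^p`,
where `μ̄_N = (M_N / E[M_N]) E[μ_N]` and `M_N = μ_N(Q_N)`. -/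
theorem main_theorem_dim2 (p : ℝ) (hp : 1 ≤ p) :
    ∃ C : ℝ, 0 < C ∧
      ∀ (N : ℝ), 0 < N →
      ∀ (Ω : Type) (_ : MeasurableSpace Ω) (P : Measure Ω), IsProbabilityMeasure P →
      ∀ (μ : Ω → Measure (EuclideanSpace ℝ (Fin 2))),
      (∀ ω, IsFiniteMeasure (μ ω)) →
      (∀ ω, μ ω (QN N)ᶜ = 0) →
      (∀ B : Set (EuclideanSpace ℝ (Fin 2)), MeasurableSet B →
        Measurable fun ω => μ ω B) →
      ∀ (Eμ : Measure (EuclideanSpace ℝ (Fin 2))),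
      (∀ B : Set (EuclideanSpace ℝ (Fin 2)), MeasurableSet B →
        Eμ B = ∫⁻ ω, μ ω B ∂P) →
      ∀ (g : ℝ → ℝ),
      (∀ y, 1 ≤ y → 0 < g y) →
      (MonotoneOn g (Set.Ici 1) ∨ AntitoneOn g (Set.Ici 1)) →
      -- Hypothesis 1: moment bound on squares of volume at least 1
      (∀ B : Set (EuclideanSpace ℝ (Fin 2)), IsAxisSquare B → B ⊆ QN N →
        1 ≤ (volume B).toReal →
        ∫⁻ ω, ENNReal.ofReal (|(μ ω B).toReal - (Eμ B).toReal| ^ p) ∂P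
          ≤ ENNReal.ofReal ((volume B).toReal ^ (p / 2)
              * g ((volume B).toReal) ^ p)) →
      ∀ (a A : ℝ), a ∈ Set.Ioc (0 : ℝ) 1 → A ∈ Set.Ici (1 : ℝ) →
      -- Hypothesis 2: density of the mean measure between a and A
      (∀ B : Set (EuclideanSpace ℝ (Fin 2)), IsAxisSquare B → B ⊆ QN N →
        ENNReal.ofReal (a * (volume B).toReal) ≤ Eμ B ∧
          Eμ B ≤ ENNReal.ofReal (A * (volume B).toReal)) →
      -- Conclusion
      ∫⁻ ω, WpPow p (μ ω) ((μ ω (QN N) / Eμ (QN N)) • Eμ) ∂P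
        ≤ ENNReal.ofReal (C * a ^ (1 - 2 * p) * A ^ p * N *
            (1 + ∫ y in (1:ℝ)..(max 1 N), g y / y) ^ p) := by
  have p0 : 0 < p := by linarith
  refine ⟨2 ^ p * 160 ^ p, by positivity, ?_⟩
  intro N hN Ω _ P _ μ hfin hcar hmeas Eμ hE g hg hm hmom a A ha hA hd
  set φ := euclideanPlaneEquiv
  have hφ : Measurable φ := φ.measurable
  have hpre : φ ⁻¹' closedSquare 0 0 (Real.sqrt N) = QN N := preimage_closedSquare_zero N
  have hQ : MeasurableSet (QN N) := by
    rw [← hpre]; exact hφ (measurableSet_closedSquare _ _ _)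
  have hsub : ∀ x y s, closedSquare x y s ⊆ closedSquare 0 0 (Real.sqrt N) →
      φ ⁻¹' closedSquare x y s ⊆ QN N := fun x y s h => by
    rw [← hpre]; exact Set.preimage_mono h
  obtain ⟨K, hK, hKi⟩ := exists_coupling_closedSquare hp hN P (fun ω => (μ ω).map φ)
    (fun ω => inferInstance)
    (fun ω => by rw [φ.map_apply, Set.preimage_compl, hpre]; exact hcar ω)
    (fun B hB => by simpa only [φ.map_apply] using hmeas _ (hφ hB)) (Eμ.map φ)
    (fun B hB => by simpa only [φ.map_apply] using hE _ (hφ hB)) g hg hm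
    (fun x y s hs h => by
      have hs0 : 0 ≤ s := by linarith
      have := hmom _ (isAxisSquare_preimage_closedSquare x y hs0) (hsub x y s h)
        (by rw [volume_preimage_closedSquare x y hs0]; exact one_le_pow₀ hs)
      rw [volume_preimage_closedSquare x y hs0, ← Real.rpow_natCast s 2, ← Real.rpow_mul hs0,
        Nat.cast_ofNat, mul_div_cancel₀ _ (two_ne_zero)] at this
      simpa only [Measure.real, φ.map_apply, ← Real.rpow_ofNat] using this)
    ha.1 ha.2 hA
    (fun x y s hs h => by
      have := hd _ (isAxisSquare_preimage_closedSquare x y hs) (hsub x y s h)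
      rw [volume_preimage_closedSquare x y hs] at this
      simpa only [φ.map_apply] using this)
  have hW : ∀ᵐ ω ∂P, WpPow p (μ ω) ((μ ω (QN N) / Eμ (QN N)) • Eμ) ≤ 2 ^ p * K ω := by
    filter_upwards [hK] with ω hω
    have h1 := hω.map p0.le φ.symm.measurable lipschitzWith_euclideanPlaneEquiv_symm
    rw [Measure.map_smul, φ.map_symm_map, φ.map_symm_map, φ.map_apply, φ.map_apply, hpre] at h1
    exact h1.wpPow_le
  refine (lintegral_mono_ae hW).trans ?_
  rw [lintegral_const_mul' _ _ (by finiteness)]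
  refine (mul_le_mul_right hKi _).trans (le_of_eq ?_)
  have hI0 : 0 ≤ ∫ y in (1 : ℝ)..(max 1 N), g y / y :=
    intervalIntegral.integral_nonneg (le_max_left _ _) fun y hy =>
      div_nonneg (hg y hy.1).le (by linarith [hy.1])
  have h2 : (2 : ℝ≥0∞) ^ p = ENNReal.ofReal (2 ^ p) := by
    rw [← ENNReal.ofReal_rpow_of_pos two_pos, ENNReal.ofReal_ofNat]
  rw [h2, ← ENNReal.ofReal_mul (by positivity), Real.mul_rpow (by norm_num) (by positivity)]
  congr 1
  ring
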